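/- Let n₁,…,n_m ≥ 1, let 1 ≤ r₁,…,r_m < ∞, let Y be an infinite dimensional Banach space and let q > 0. If every continuous (n₁,…,n_m)-homogeneous polynomial from ℓ_{r₁} × ⋯ × ℓ_{r_m} into Y is absolutely (q;1)-summing, then q ≥ min{1/(n₁/r₁ + ⋯ + n_m/r_m), cot Y}; precisely, either q ≥ 1/(n₁/r₁ + ⋯ + n_m/r_m), or q ≥ 2 and Y has cotype s for every s > q. -/

import Mathlib

open scoped BigOperators

/-- A sequence in a normed space is *weakly 1-summable*. -/
def WeaklySummable (𝕂 : Type*) [RCLike 𝕂] {X : Type*} [NormedAddCommGroup X]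
    [NormedSpace 𝕂 X] (x : ℕ → X) : Prop :=
  ∀ φ : X →L[𝕂] 𝕂, Summable fun j => ‖φ (x j)‖

/-- `P` is a continuous `(n 0, …, n (m-1))`-homogeneous polynomial, i.e. it comes from a
continuous multilinear map in `n 0 + ⋯ + n (m-1)` variables (`n k` copies of `X k`). -/
def IsMultiPoly (𝕂 : Type*) [RCLike 𝕂] {m : ℕ} (n : Fin m → ℕ)
    {X : Fin m → Type*} [∀ k, NormedAddCommGroup (X k)] [∀ k, NormedSpace 𝕂 (X k)]
    {Y : Type*} [NormedAddCommGroup Y] [NormedSpace 𝕂 Y]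
    (P : (∀ k, X k) → Y) : Prop :=
  ∃ T : ContinuousMultilinearMap 𝕂 (fun i : Σ k : Fin m, Fin (n k) => X i.1) Y,
    ∀ x : ∀ k, X k, P x = T fun i => x i.1

/-- A normed space has cotype `q` (Rademacher averages written as an average over signs). -/
def HasCotype (X : Type*) [NormedAddCommGroup X] (q : ℝ) : Prop :=
  ∃ C : ℝ, 0 ≤ C ∧ ∀ (k : ℕ) (x : Fin k → X),
    (∑ j, ‖x j‖ ^ q) ^ (1 / q) ≤
      C * Real.sqrt ((2 ^ k : ℝ)⁻¹ *
        ∑ ε : Fin k → Bool, ‖∑ j, (if ε j then x j else -x j)‖ ^ 2)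

section Signs

open Finset
open scoped BigOperators

/-- The real sign `±1` attached to a Boolean. -/
def boolSign (b : Bool) : ℝ := if b then 1 else -1

lemma boolSign_not (b : Bool) : boolSign (!b) = -boolSign b := by
  cases b <;> simp [boolSign]

lemma abs_boolSign (b : Bool) : |boolSign b| = 1 := by
  cases b <;> simp [boolSign]

lemma boolSign_mul_self (b : Bool) : boolSign b * boolSign b = 1 := by
  cases b <;> simp [boolSign]

lemma boolSign_beq (b c : Bool) : boolSign (b == c) = boolSign b * boolSign c := by
  cases b <;> cases c <;> simp [boolSign]

/-- The second moment of the Rademacher sum of a finite family of vectors. -/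
noncomputable def radSq {Y : Type*} [NormedAddCommGroup Y] [NormedSpace ℝ Y]
    {ι : Type*} [Fintype ι] [DecidableEq ι] (x : ι → Y) : ℝ :=
  𝔼 ε : ι → Bool, ‖∑ i, boolSign (ε i) • x i‖ ^ 2

variable {ι κ : Type*} [Fintype ι] [DecidableEq ι] [Fintype κ] [DecidableEq κ]

/-- Averages over signs are not affected by further independent signs. -/
lemma expect_signs_comp {e : κ → ι} (he : Function.Injective e) (G : (κ → Bool) → ℝ) :
    𝔼 ε : ι → Bool, G (ε ∘ e) = 𝔼 δ : κ → Bool, G δ := by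
  classical
  let E : κ ⊕ {i // i ∉ Set.range e} ≃ ι :=
    (Equiv.sumCongr (Equiv.ofInjective e he) (Equiv.refl _)).trans
      (Equiv.sumCompl (fun i => i ∈ Set.range e))
  let F : (ι → Bool) ≃ (κ → Bool) × ({i // i ∉ Set.range e} → Bool) :=
    (Equiv.arrowCongr E.symm (Equiv.refl Bool)).trans (Equiv.sumArrowEquivProdArrow _ _ _)
  have hF : ∀ ε : ι → Bool, (F ε).1 = ε ∘ e := fun ε => rfl
  rw [Fintype.expect_equiv F _ (fun p => G p.1) (fun ε => by rw [hF]), ← univ_product_univ,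
    expect_product]
  simp

/-- Averages over signs are invariant under multiplication by a fixed sign pattern. -/
lemma expect_signs_beq (η : ι → Bool) (G : (ι → Bool) → ℝ) :
    𝔼 ε : ι → Bool, G (fun i => ε i == η i) = 𝔼 ε, G ε := by
  have hinv : Function.Involutive (fun (ε : ι → Bool) i => ε i == η i) := by
    intro ε
    funext i
    cases h : ε i <;> cases h' : η i <;> simp [h, h']
  exact Fintype.expect_bijective _ hinv.bijective _ _ (fun ε => rfl)

variable {Y : Type*} [NormedAddCommGroup Y] [NormedSpace ℝ Y]

lemma radSq_nonneg (x : ι → Y) : 0 ≤ radSq x :=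
  expect_nonneg fun _ _ => by positivity

lemma radSq_boolSign_smul (η : ι → Bool) (x : ι → Y) :
    radSq (fun i => boolSign (η i) • x i) = radSq x := by
  unfold radSq
  rw [← expect_signs_beq η (fun ε => ‖∑ i, boolSign (ε i) • x i‖ ^ 2)]
  simp only [boolSign_beq, mul_smul]

lemma radSq_comp_equiv (e : κ ≃ ι) (x : ι → Y) : radSq (x ∘ e) = radSq x := by
  unfold radSq
  rw [← expect_signs_comp e.injective]
  refine expect_congr rfl fun ε _ => ?_
  rw [← Equiv.sum_comp e]
  rfl

lemma norm_sq_le_half_add (u v : Y) : ‖u‖ ^ 2 ≤ (‖u + v‖ ^ 2 + ‖u - v‖ ^ 2) / 2 := by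
  have h : ‖u‖ ≤ (‖u + v‖ + ‖u - v‖) / 2 := by
    have h1 : u = (1 / 2 : ℝ) • ((u + v) + (u - v)) := by
      rw [add_add_sub_cancel, ← two_smul ℝ u, smul_smul]; norm_num
    have h2 := norm_add_le (u + v) (u - v)
    calc ‖u‖ = ‖(1 / 2 : ℝ) • ((u + v) + (u - v))‖ := by rw [← h1]
      _ = 1 / 2 * ‖(u + v) + (u - v)‖ := by rw [norm_smul]; norm_num
      _ ≤ _ := by linarith
  nlinarith [sq_nonneg (‖u + v‖ - ‖u - v‖), norm_nonneg u]

/-- Rademacher averages decrease when passing to a subfamily. -/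
lemma radSq_comp_le {e : κ → ι} (he : Function.Injective e) (x : ι → Y) :
    radSq (x ∘ e) ≤ radSq x := by
  classical
  unfold radSq
  rw [← expect_signs_comp he]
  let η : ι → Bool := fun i => decide (i ∈ univ.image e)
  have h2 : 𝔼 ε : ι → Bool, ‖∑ i, boolSign (ε i) • x i‖ ^ 2 =
      𝔼 ε : ι → Bool, (‖∑ i, boolSign (ε i) • x i‖ ^ 2 +
        ‖∑ i, boolSign (ε i == η i) • x i‖ ^ 2) / 2 := by
    rw [← expect_div, expect_add_distrib,
      expect_signs_beq η (fun ε => ‖∑ i, boolSign (ε i) • x i‖ ^ 2)]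
    ring
  rw [h2]
  refine expect_le_expect fun ε _ => ?_
  have hsum : ∑ j, boolSign ((ε ∘ e) j) • (x ∘ e) j =
      ∑ i ∈ univ.image e, boolSign (ε i) • x i := by
    rw [sum_image he.injOn]; rfl
  have ha : ∑ i, boolSign (ε i) • x i =
      ∑ i ∈ univ.image e, boolSign (ε i) • x i + ∑ i ∈ (univ.image e)ᶜ, boolSign (ε i) • x i :=
    (sum_add_sum_compl _ _).symm
  have hb : ∑ i, boolSign (ε i == η i) • x i =
      ∑ i ∈ univ.image e, boolSign (ε i) • x i - ∑ i ∈ (univ.image e)ᶜ, boolSign (ε i) • x i := by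
    rw [← sum_add_sum_compl (univ.image e), sub_eq_add_neg, ← sum_neg_distrib]
    congr 1
    · refine sum_congr rfl fun i hi => ?_
      have : η i = true := by simpa [η] using hi
      simp [this]
    · refine sum_congr rfl fun i hi => ?_
      have : η i = false := by simpa [η] using hi
      simp [this, boolSign_not]
  rw [hsum, ha, hb]
  exact norm_sq_le_half_add _ _

lemma expect_boolSign_mul (i j : ι) :
    𝔼 ε : ι → Bool, boolSign (ε i) * boolSign (ε j) = if i = j then 1 else 0 := by
  classical
  split_ifs with h
  · subst h
    simp [boolSign_mul_self]
  · let η : ι → Bool := fun l => decide (l ≠ i)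
    have h1 := expect_signs_beq η (fun ε => boolSign (ε i) * boolSign (ε j))
    have h2 : ∀ ε : ι → Bool, boolSign (ε i == η i) * boolSign (ε j == η j) =
        -(boolSign (ε i) * boolSign (ε j)) := by
      intro ε
      have hi : η i = false := by simp [η]
      have hj : η j = true := by simpa [η] using fun hji => h hji.symm
      simp [hi, hj, boolSign_not]
    simp only [h2, expect_neg_distrib] at h1
    linarith

lemma expect_sq_sum_boolSign (c : ι → ℝ) :
    𝔼 ε : ι → Bool, (∑ i, boolSign (ε i) * c i) ^ 2 = ∑ i, c i ^ 2 := by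
  have h : ∀ ε : ι → Bool, (∑ i, boolSign (ε i) * c i) ^ 2 =
      ∑ i, ∑ j, (c i * c j) * (boolSign (ε i) * boolSign (ε j)) := by
    intro ε
    rw [sq, sum_mul_sum]
    exact sum_congr rfl fun i _ => sum_congr rfl fun j _ => by ring
  simp only [h, expect_sum_comm, ← mul_expect, expect_boolSign_mul]
  simp [sq]

lemma sum_sq_dual_le_radSq (x : ι → Y) (φ : Y →L[ℝ] ℝ) (hφ : ‖φ‖ ≤ 1) :
    ∑ i, φ (x i) ^ 2 ≤ radSq x := by
  rw [← expect_sq_sum_boolSign]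
  refine expect_le_expect fun ε _ => ?_
  have h : ∑ i, boolSign (ε i) * φ (x i) = φ (∑ i, boolSign (ε i) • x i) := by
    simp [map_sum]
  rw [h, ← sq_abs]
  gcongr
  have h1 := φ.le_of_opNorm_le hφ (∑ i, boolSign (ε i) • x i)
  rwa [Real.norm_eq_abs, one_mul] at h1

end Signs

section Symmetrization

open Finset
open scoped BigOperators

variable {T : Type*}

/-- A real function with bounded absolute value. -/
def AbsBounded (h : T → ℝ) : Prop := ∃ C, ∀ φ, |h φ| ≤ C

lemma AbsBounded.add {h g : T → ℝ} (hh : AbsBounded h) (hg : AbsBounded g) :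
    AbsBounded fun φ => h φ + g φ := by
  obtain ⟨C, hC⟩ := hh
  obtain ⟨D, hD⟩ := hg
  exact ⟨C + D, fun φ => (abs_add_le _ _).trans (add_le_add (hC φ) (hD φ))⟩

lemma AbsBounded.const_mul {h : T → ℝ} (hh : AbsBounded h) (c : ℝ) :
    AbsBounded fun φ => c * h φ := by
  obtain ⟨C, hC⟩ := hh
  exact ⟨|c| * C, fun φ => by rw [abs_mul]; gcongr; exact hC φ⟩

lemma AbsBounded.sub {h g : T → ℝ} (hh : AbsBounded h) (hg : AbsBounded g) :
    AbsBounded fun φ => h φ - g φ := by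
  simpa [sub_eq_add_neg] using hh.add (hg.const_mul (-1))

lemma AbsBounded.abs {h : T → ℝ} (hh : AbsBounded h) : AbsBounded fun φ => |h φ| := by
  obtain ⟨C, hC⟩ := hh
  exact ⟨C, fun φ => by rw [abs_abs]; exact hC φ⟩

lemma AbsBounded.sum {ι : Type*} {s : Finset ι} {h : ι → T → ℝ} (hh : ∀ i, AbsBounded (h i)) :
    AbsBounded fun φ => ∑ i ∈ s, h i φ := by
  choose C hC using hh
  exact ⟨∑ i ∈ s, C i, fun φ => (abs_sum_le_sum_abs _ _).trans (sum_le_sum fun i _ => hC i φ)⟩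

lemma AbsBounded.expect {ι : Type*} [Fintype ι] {h : ι → T → ℝ} (hh : ∀ i, AbsBounded (h i)) :
    AbsBounded fun φ => 𝔼 i, h i φ := by
  simp only [Fintype.expect_eq_sum_div_card, div_eq_inv_mul]
  exact (AbsBounded.sum hh).const_mul _

lemma AbsBounded.bddAbove {h : T → ℝ} (hh : AbsBounded h) : BddAbove (Set.range h) := by
  obtain ⟨C, hC⟩ := hh
  exact ⟨C, by rintro _ ⟨φ, rfl⟩; exact (le_abs_self _).trans (hC φ)⟩

lemma AbsBounded.le_iSup {h : T → ℝ} (hh : AbsBounded h) (φ : T) : h φ ≤ ⨆ ψ, h ψ :=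
  _root_.le_ciSup hh.bddAbove φ

lemma iSup_add_abs_add_iSup_sub_abs_le [Nonempty T] {h u : T → ℝ} (hh : AbsBounded h)
    (hu : AbsBounded u) :
    (⨆ φ, (h φ + 2 * |u φ|)) + (⨆ φ, (h φ - 2 * |u φ|)) ≤
      (⨆ φ, (h φ + 2 * u φ)) + (⨆ φ, (h φ - 2 * u φ)) := by
  have h1 := (hh.add (hu.const_mul 2)).le_iSup
  have h2 := (hh.sub (hu.const_mul 2)).le_iSup
  have key : ∀ φ ψ, (h φ + 2 * |u φ|) + (h ψ - 2 * |u ψ|) ≤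
      (⨆ φ, (h φ + 2 * u φ)) + (⨆ φ, (h φ - 2 * u φ)) := by
    intro φ ψ
    rcases abs_cases (u φ) with ⟨h3, _⟩ | ⟨h3, _⟩
    · have := h1 φ
      have := h2 ψ
      have := le_abs_self (u ψ)
      linarith
    · have := h2 φ
      have := h1 ψ
      have := neg_abs_le (u ψ)
      linarith
  rw [← le_sub_iff_add_le]
  refine ciSup_le fun φ => ?_
  rw [le_sub_iff_add_le, add_comm, ← le_sub_iff_add_le]
  refine ciSup_le fun ψ => ?_
  have := key φ ψ
  linarith

variable {κ : Type*} [Fintype κ] [Nonempty κ]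

lemma expect_iSup_add_abs_le [Nonempty T] {h : T → ℝ} {u : κ → T → ℝ} (hh : AbsBounded h)
    (hu : ∀ i, AbsBounded (u i)) :
    𝔼 i, ⨆ φ, (h φ + |u i φ|) ≤
      𝔼 i, 𝔼 b : Bool, ⨆ φ, (h φ + 𝔼 j, |u j φ| + 2 * (boolSign b * u i φ)) := by
  set g : T → ℝ := fun φ => h φ + 𝔼 j, |u j φ| with hg
  have hgb : AbsBounded g := hh.add (AbsBounded.expect fun i => (hu i).abs)
  have h1 : ∀ i, ⨆ φ, (h φ + |u i φ|) ≤
      𝔼 j, ((⨆ φ, (g φ + 2 * |u i φ|)) + (⨆ φ, (g φ - 2 * |u j φ|))) / 2 := by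
    intro i
    refine ciSup_le fun φ => ?_
    have e1 : h φ + |u i φ| = 𝔼 j, (g φ + |u i φ| - |u j φ|) := by
      rw [expect_sub_distrib, Fintype.expect_const]
      simp only [hg]
      ring
    rw [e1]
    refine expect_le_expect fun j _ => ?_
    have h2 := (hgb.add ((hu i).abs.const_mul 2)).le_iSup φ
    have h3 := (hgb.sub ((hu j).abs.const_mul 2)).le_iSup φ
    linarith
  calc 𝔼 i, ⨆ φ, (h φ + |u i φ|)
      ≤ 𝔼 i, 𝔼 j, ((⨆ φ, (g φ + 2 * |u i φ|)) + (⨆ φ, (g φ - 2 * |u j φ|))) / 2 :=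
        expect_le_expect fun i _ => h1 i
    _ = 𝔼 i, ((⨆ φ, (g φ + 2 * |u i φ|)) + (⨆ φ, (g φ - 2 * |u i φ|))) / 2 := by
        simp only [← expect_div, expect_add_distrib, Fintype.expect_const]
    _ ≤ 𝔼 i, ((⨆ φ, (g φ + 2 * u i φ)) + (⨆ φ, (g φ - 2 * u i φ))) / 2 := by
        refine expect_le_expect fun i _ => ?_
        have := iSup_add_abs_add_iSup_sub_abs_le hgb (hu i)
        linarith
    _ = _ := by
        refine expect_congr rfl fun i _ => ?_
        rw [Fintype.expect_eq_sum_div_card]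
        simp [boolSign, sub_eq_add_neg, hg]

lemma expect_fin_succ {α : Type*} [Fintype α] {k : ℕ} (f : (Fin (k + 1) → α) → ℝ) :
    𝔼 a, f a = 𝔼 i, 𝔼 a, f (Fin.cons i a) := by
  rw [← expect_product', univ_product_univ]
  exact (Fintype.expect_equiv (Fin.consEquiv fun _ => α) _ _ fun p => rfl).symm

/-- Symmetrization together with the contraction principle for the absolute value. -/
lemma expect_iSup_add_sum_abs_le [Nonempty T] {k : ℕ} {h : T → ℝ} {u : Fin k → κ → T → ℝ}
    (hh : AbsBounded h) (hu : ∀ l i, AbsBounded (u l i)) :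
    𝔼 a : Fin k → κ, ⨆ φ, (h φ + ∑ l, |u l (a l) φ|) ≤
      𝔼 a : Fin k → κ, 𝔼 ε : Fin k → Bool,
        ⨆ φ, (h φ + ∑ l, 𝔼 j, |u l j φ| + 2 * ∑ l, boolSign (ε l) * u l (a l) φ) := by
  induction k generalizing h with
  | zero => simp
  | succ k ih =>
    rw [expect_fin_succ]
    have h1 : ∀ i, 𝔼 a : Fin k → κ, ⨆ φ, (h φ + ∑ l, |u l (Fin.cons (α := fun _ => κ) i a l) φ|) ≤
        𝔼 a : Fin k → κ, 𝔼 ε : Fin k → Bool, ⨆ φ, ((h φ + ∑ l : Fin k, 𝔼 j, |u l.succ j φ| +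
          2 * ∑ l : Fin k, boolSign (ε l) * u l.succ (a l) φ) + |u 0 i φ|) := by
      intro i
      refine le_trans (le_of_eq ?_) ((ih (u := fun l => u l.succ) (hh.add (hu 0 i).abs)
        (fun l => hu l.succ)).trans (le_of_eq ?_))
      · refine expect_congr rfl fun a _ => iSup_congr fun φ => ?_
        rw [Fin.sum_univ_succ]
        simp only [Fin.cons_zero, Fin.cons_succ]
        ring
      · refine expect_congr rfl fun a _ => expect_congr rfl fun ε _ => iSup_congr fun φ => ?_
        ring
    refine (expect_le_expect fun i _ => h1 i).trans ?_
    rw [expect_comm]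
    have h2 : ∀ a : Fin k → κ, 𝔼 i, 𝔼 ε : Fin k → Bool,
        ⨆ φ, ((h φ + ∑ l : Fin k, 𝔼 j, |u l.succ j φ| +
          2 * ∑ l : Fin k, boolSign (ε l) * u l.succ (a l) φ) + |u 0 i φ|) ≤
        𝔼 ε : Fin k → Bool, 𝔼 i, 𝔼 b : Bool,
          ⨆ φ, ((h φ + ∑ l : Fin k, 𝔼 j, |u l.succ j φ| +
          2 * ∑ l : Fin k, boolSign (ε l) * u l.succ (a l) φ) + 𝔼 j, |u 0 j φ| +
            2 * (boolSign b * u 0 i φ)) := by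
      intro a
      rw [expect_comm]
      refine expect_le_expect fun ε _ => ?_
      refine expect_iSup_add_abs_le ?_ (hu 0)
      exact (hh.add (AbsBounded.sum fun l => AbsBounded.expect fun j => (hu _ j).abs)).add
        ((AbsBounded.sum fun l => (hu _ _).const_mul _).const_mul 2)
    refine (expect_le_expect fun a _ => h2 a).trans (le_of_eq ?_)
    rw [expect_fin_succ]
    simp only [expect_fin_succ (α := Bool)]
    rw [expect_comm (univ : Finset κ)]
    refine expect_congr rfl fun a _ => ?_
    rw [expect_comm]
    refine expect_congr rfl fun i _ => ?_
    rw [expect_comm]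
    refine expect_congr rfl fun b _ => expect_congr rfl fun ε _ => iSup_congr fun φ => ?_
    simp only [Fin.sum_univ_succ, Fin.cons_zero, Fin.cons_succ]
    ring

end Symmetrization

section DecreasingRearrangement

open Finset
open scoped BigOperators

/-- If every nonempty finite set has an element on which `f` is at most `g` of the cardinality,
then sums of `f` are bounded by initial sums of `g`. -/
lemma sum_le_sum_range_of_forall_exists_le {ι : Type*} {f : ι → ℝ} {g : ℕ → ℝ}
    {S : Finset ι} (H : ∀ T ⊆ S, T.Nonempty → ∃ i ∈ T, f i ≤ g #T) :
    ∑ i ∈ S, f i ≤ ∑ l ∈ range #S, g (l + 1) := by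
  classical
  induction hn : #S generalizing S with
  | zero => simp [card_eq_zero.mp hn]
  | succ n ih =>
    obtain ⟨i, hi, hfi⟩ := H S Subset.rfl (card_pos.mp (by omega))
    have hc : #(S.erase i) = n := by rw [card_erase_of_mem hi, hn]; rfl
    rw [sum_range_succ, ← sum_erase_add S f hi]
    refine add_le_add (ih (fun T hT => H T (hT.trans (erase_subset _ _))) hc) ?_
    rwa [hn] at hfi

lemma rpow_sub_one_le_rpow_sub {u : ℝ} (hu : 0 < u) (hu1 : u ≤ 1) (l : ℕ) :
    ((l + 1 : ℕ) : ℝ) ^ (u - 1) ≤ (((l + 1 : ℕ) : ℝ) ^ u - (l : ℝ) ^ u) / u := by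
  have hx : (0 : ℝ) < ((l + 1 : ℕ) : ℝ) := by positivity
  have h := rpow_one_add_le_one_add_mul_self (s := -(1 / ((l + 1 : ℕ) : ℝ))) (p := u)
    (by rw [neg_le_neg_iff, div_le_one hx]; push_cast; linarith [(Nat.cast_nonneg l : (0 : ℝ) ≤ l)])
    hu.le hu1
  have h2 : (l : ℝ) = ((l + 1 : ℕ) : ℝ) * (1 + -(1 / ((l + 1 : ℕ) : ℝ))) := by
    field_simp; push_cast; ring
  have h3 : (0 : ℝ) ≤ 1 + -(1 / ((l + 1 : ℕ) : ℝ)) := by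
    have : 1 / ((l + 1 : ℕ) : ℝ) ≤ 1 := by
      rw [div_le_one hx]; push_cast; linarith [(Nat.cast_nonneg l : (0 : ℝ) ≤ l)]
    linarith
  rw [le_div_iff₀ hu, h2, Real.mul_rpow hx.le h3, Real.rpow_sub_one hx.ne']
  have h4 := mul_le_mul_of_nonneg_left h (Real.rpow_nonneg hx.le u)
  calc ((l + 1 : ℕ) : ℝ) ^ u / ((l + 1 : ℕ) : ℝ) * u
      = ((l + 1 : ℕ) : ℝ) ^ u - ((l + 1 : ℕ) : ℝ) ^ u * (1 + u * -(1 / ((l + 1 : ℕ) : ℝ))) := by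
        ring
    _ ≤ _ := by linarith

lemma sum_range_rpow_sub_one_le {u : ℝ} (hu : 0 < u) (hu1 : u ≤ 1) (n : ℕ) :
    ∑ l ∈ range n, ((l + 1 : ℕ) : ℝ) ^ (u - 1) ≤ (n : ℝ) ^ u / u := by
  refine (sum_le_sum fun l _ => rpow_sub_one_le_rpow_sub hu hu1 l).trans ?_
  rw [← sum_div, sum_range_sub (fun l : ℕ => (l : ℝ) ^ u)]
  simp [Real.zero_rpow hu.ne']

end DecreasingRearrangement

section Cotype

open Finset
open scoped BigOperators

variable {Y : Type*} [NormedAddCommGroup Y] [NormedSpace ℝ Y]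

/-- The identity of `Y` is `(s, 1)`-summing: the `s`-sums of the norms of a finite family are
controlled by its bounded combinations. -/
def HasOrlicz (Y : Type*) [NormedAddCommGroup Y] [NormedSpace ℝ Y] (s : ℝ) : Prop :=
  ∃ K : ℝ, ∀ (n : ℕ) (x : Fin n → Y) (M : ℝ),
    (∀ a : Fin n → ℝ, (∀ i, |a i| ≤ 1) → ‖∑ i, a i • x i‖ ≤ M) → ∑ i, ‖x i‖ ^ s ≤ K * M ^ s

lemma expect_le_sqrt_expect_sq {ι : Type*} [Fintype ι] (f : ι → ℝ) :
    𝔼 i, f i ≤ √(𝔼 i, f i ^ 2) := by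
  rcases isEmpty_or_nonempty ι with h | h
  · simp
  apply Real.le_sqrt_of_sq_le
  have h1 : 0 ≤ 𝔼 i, (f i - 𝔼 j, f j) ^ 2 := expect_nonneg fun _ _ => sq_nonneg _
  have h2 : ∀ m, 𝔼 i, (f i - m) ^ 2 = 𝔼 i, f i ^ 2 - 2 * m * 𝔼 i, f i + m ^ 2 := by
    intro m
    simp only [sub_sq, expect_add_distrib, expect_sub_distrib, Fintype.expect_const, mul_expect]
    congr 2
    exact expect_congr rfl fun i _ => by ring
  rw [h2] at h1
  nlinarith

lemma radSq_smul {ι : Type*} [Fintype ι] [DecidableEq ι] (c : ℝ) (x : ι → Y) :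
    radSq (fun i => c • x i) = c ^ 2 * radSq x := by
  unfold radSq
  rw [mul_expect]
  refine expect_congr rfl fun ε _ => ?_
  simp only [smul_comm _ c, ← smul_sum, norm_smul, mul_pow, Real.norm_eq_abs, sq_abs]

/-- The supremum of `∑ |φ (x l)|` over the dual unit ball. -/
noncomputable def weakSum {ι : Type*} [Fintype ι] (x : ι → Y) : ℝ :=
  ⨆ φ : {φ : Y →L[ℝ] ℝ // ‖φ‖ ≤ 1}, ∑ l, |φ.1 (x l)|

lemma absBounded_dual (y : Y) :
    AbsBounded fun φ : {φ : Y →L[ℝ] ℝ // ‖φ‖ ≤ 1} => φ.1 y :=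
  ⟨‖y‖, fun φ => by simpa using φ.1.le_of_opNorm_le φ.2 y⟩

lemma norm_sum_smul_le_weakSum {ι : Type*} [Fintype ι] (x : ι → Y) (a : ι → ℝ)
    (ha : ∀ i, |a i| ≤ 1) : ‖∑ i, a i • x i‖ ≤ weakSum x := by
  obtain ⟨φ, hφ, h⟩ := exists_dual_vector'' ℝ (∑ i, a i • x i)
  have h1 : ‖∑ i, a i • x i‖ = ∑ i, a i * φ (x i) := by
    have : φ (∑ i, a i • x i) = ‖∑ i, a i • x i‖ := by simpa using h
    rw [← this]; simp [map_sum]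
  rw [h1]
  refine le_trans (sum_le_sum fun i _ => ?_)
    ((AbsBounded.sum fun l => (absBounded_dual (x l)).abs).le_iSup ⟨φ, hφ⟩)
  calc a i * φ (x i) ≤ |a i| * |φ (x i)| := by rw [← abs_mul]; exact le_abs_self _
    _ ≤ 1 * |φ (x i)| := by gcongr; exact ha i
    _ = _ := one_mul _

instance : Nonempty {φ : Y →L[ℝ] ℝ // ‖φ‖ ≤ 1} := ⟨⟨0, by simp⟩⟩

/-- Random selections from `k` blocks of vectors. -/
lemma expect_weakSum_le {k : ℕ} {κ : Type*} [Fintype κ] [DecidableEq κ] [Nonempty κ]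
    (x : Fin k → κ → Y) :
    𝔼 a : Fin k → κ, weakSum (fun l => x l (a l)) ≤
      √(k / Fintype.card κ) * √(radSq fun p : Fin k × κ => x p.1 p.2) +
        2 * √(𝔼 a : Fin k → κ, radSq fun l => x l (a l)) := by
  set R := √(radSq fun p : Fin k × κ => x p.1 p.2) with hR
  have hN : (0 : ℝ) < Fintype.card κ := by exact_mod_cast Fintype.card_pos
  have h1 := expect_iSup_add_sum_abs_le (T := {φ : Y →L[ℝ] ℝ // ‖φ‖ ≤ 1}) (k := k) (h := 0)
    (u := fun l i φ => φ.1 (x l i)) ⟨0, by simp⟩ (fun l i => absBounded_dual (x l i))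
  simp only [Pi.zero_apply, zero_add] at h1
  refine h1.trans ?_
  have h2 : ∀ (a : Fin k → κ) (ε : Fin k → Bool),
      ⨆ φ : {φ : Y →L[ℝ] ℝ // ‖φ‖ ≤ 1}, (∑ l, 𝔼 j, |φ.1 (x l j)| +
        2 * ∑ l, boolSign (ε l) * φ.1 (x l (a l))) ≤
      √(k / Fintype.card κ) * R + 2 * ‖∑ l, boolSign (ε l) • x l (a l)‖ := by
    intro a ε
    refine ciSup_le fun φ => add_le_add ?_ ?_
    · have e1 : ∑ l, 𝔼 j, |φ.1 (x l j)| =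
          (∑ p : Fin k × κ, |φ.1 (x p.1 p.2)|) / Fintype.card κ := by
        simp only [Fintype.expect_eq_sum_div_card, ← sum_div, Fintype.sum_prod_type]
      have e2 : ∑ p : Fin k × κ, |φ.1 (x p.1 p.2)| ≤ √(k * Fintype.card κ) * R := by
        rw [hR, ← Real.sqrt_mul (by positivity)]
        apply Real.le_sqrt_of_sq_le
        have e3 := sq_sum_le_card_mul_sum_sq (s := (univ : Finset (Fin k × κ)))
          (f := fun p => |φ.1 (x p.1 p.2)|)
        simp only [sq_abs, card_univ, Fintype.card_prod, Fintype.card_fin, Nat.cast_mul] at e3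
        refine e3.trans ?_
        gcongr
        exact sum_sq_dual_le_radSq (fun p : Fin k × κ => x p.1 p.2) φ.1 φ.2
      rw [e1, div_le_iff₀ hN]
      refine e2.trans (le_of_eq ?_)
      have e4 : √(k * Fintype.card κ) = √(k / Fintype.card κ) * Fintype.card κ := by
        rw [show (k : ℝ) * Fintype.card κ = k / Fintype.card κ * (Fintype.card κ : ℝ) ^ 2 by
          field_simp, Real.sqrt_mul (by positivity), Real.sqrt_sq hN.le]
      rw [e4]; ring
    · have e1 : ∑ l, boolSign (ε l) * φ.1 (x l (a l)) =
          φ.1 (∑ l, boolSign (ε l) • x l (a l)) := by simp [map_sum]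
      rw [e1]
      have := φ.1.le_of_opNorm_le φ.2 (∑ l, boolSign (ε l) • x l (a l))
      rw [Real.norm_eq_abs, one_mul] at this
      linarith [le_abs_self (φ.1 (∑ l, boolSign (ε l) • x l (a l)))]
  refine (expect_le_expect fun a _ => expect_le_expect fun ε _ => h2 a ε).trans ?_
  simp only [expect_add_distrib, Fintype.expect_const, ← mul_expect]
  gcongr
  calc 𝔼 a : Fin k → κ, 𝔼 ε : Fin k → Bool, ‖∑ l, boolSign (ε l) • x l (a l)‖
      ≤ 𝔼 a : Fin k → κ, √(radSq fun l => x l (a l)) :=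
        expect_le_expect fun a _ => expect_le_sqrt_expect_sq _
    _ ≤ √(𝔼 a : Fin k → κ, √(radSq fun l => x l (a l)) ^ 2) := expect_le_sqrt_expect_sq _
    _ = _ := by simp only [Real.sq_sqrt (radSq_nonneg _)]

lemma expect_radSq_le {k : ℕ} {κ : Type*} [Fintype κ] [DecidableEq κ] [AddCommGroup κ]
    {C : ℝ} (hC : ∀ w : κ → Y, ∑ i, ‖w i‖ ^ 2 ≤ C * radSq w) (x : Fin k → κ → Y) :
    𝔼 a : Fin k → κ, (radSq fun l => x l (a l)) ≤
      C / Fintype.card κ * radSq fun p : Fin k × κ => x p.1 p.2 := by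
  have hN : (0 : ℝ) < Fintype.card κ := by exact_mod_cast Fintype.card_pos
  have h1 : ∀ i : κ, 𝔼 a : Fin k → κ, (radSq fun l => x l (a l)) =
      𝔼 a : Fin k → κ, (radSq fun l => x l (a l + i)) := fun i =>
    (Fintype.expect_equiv (Equiv.piCongrRight fun _ : Fin k => Equiv.addRight i) _ _
      fun a => rfl).symm
  have h2 : 𝔼 a : Fin k → κ, (radSq fun l => x l (a l)) =
      𝔼 a : Fin k → κ, 𝔼 i : κ, (radSq fun l => x l (a l + i)) := by
    rw [expect_comm]
    simp only [← h1, Fintype.expect_const]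
  rw [h2]
  refine (expect_le_expect (g := fun _ => C / Fintype.card κ *
    radSq fun p : Fin k × κ => x p.1 p.2) fun a _ => ?_).trans (by simp)
  have h3 : ∀ i : κ, (radSq fun l => x l (a l + i)) =
      𝔼 ε : Fin k × κ → Bool, ‖∑ l, boolSign (ε (l, i)) • x l (a l + i)‖ ^ 2 := fun i =>
    (expect_signs_comp (e := fun l : Fin k => (l, i)) (fun l l' h => by simpa using h)
      (fun ε => ‖∑ l, boolSign (ε l) • x l (a l + i)‖ ^ 2)).symm
  simp only [h3]
  rw [expect_comm]
  have h4 : ∀ ε : Fin k × κ → Bool, 𝔼 i, ‖∑ l, boolSign (ε (l, i)) • x l (a l + i)‖ ^ 2 ≤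
      C / Fintype.card κ * 𝔼 δ : κ → Bool,
        ‖∑ p : Fin k × κ, boolSign (ε p) • boolSign (δ p.2) • x p.1 (a p.1 + p.2)‖ ^ 2 := by
    intro ε
    rw [Fintype.expect_eq_sum_div_card, div_mul_eq_mul_div]
    gcongr
    refine (hC _).trans (le_of_eq ?_)
    unfold radSq
    congr 1
    refine expect_congr rfl fun δ _ => ?_
    congr 2
    rw [Fintype.sum_prod_type, sum_comm]
    refine sum_congr rfl fun i _ => ?_
    rw [smul_sum]
    exact sum_congr rfl fun l _ => smul_comm _ _ _
  refine (expect_le_expect fun ε _ => h4 ε).trans (le_of_eq ?_)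
  rw [← mul_expect, expect_comm]
  congr 1
  have h5 : ∀ δ : κ → Bool, 𝔼 ε : Fin k × κ → Bool,
      ‖∑ p : Fin k × κ, boolSign (ε p) • boolSign (δ p.2) • x p.1 (a p.1 + p.2)‖ ^ 2 =
      radSq fun p : Fin k × κ => x p.1 p.2 := by
    intro δ
    let E : Fin k × κ ≃ Fin k × κ := Equiv.prodShear (Equiv.refl _) fun l => Equiv.addLeft (a l)
    rw [← radSq_comp_equiv E, ← radSq_boolSign_smul (fun p : Fin k × κ => δ p.2)]
    rfl
  simp only [h5, Fintype.expect_const]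

/-- From families of equal size to Lorentz-type control of arbitrary families. -/
lemma sum_norm_rpow_le {γ B p : ℝ} (hp : 0 < p) (hB : 0 ≤ B) {N : ℕ}
    (H : ∀ n ≤ N, ∀ x : Fin n → Y, (∀ i, 1 ≤ ‖x i‖) → (n : ℝ) ^ γ ≤ B * √(radSq x))
    (w : Fin N → Y) :
    ∑ i, ‖w i‖ ^ p ≤ (B * √(radSq w)) ^ p * ∑ l ∈ range N, ((l + 1 : ℕ) : ℝ) ^ (-(γ * p)) := by
  have h := sum_le_sum_range_of_forall_exists_le (S := (univ : Finset (Fin N)))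
    (f := fun i => ‖w i‖ ^ p) (g := fun c => (B * √(radSq w)) ^ p * (c : ℝ) ^ (-(γ * p))) ?_
  · simpa [mul_sum] using h
  intro T _ hT
  obtain ⟨i, hi, hmin⟩ := exists_min_image T (fun i => ‖w i‖) hT
  refine ⟨i, hi, ?_⟩
  have hc : (0 : ℝ) < #T := by exact_mod_cast hT.card_pos
  rcases eq_or_lt_of_le (norm_nonneg (w i)) with h0 | h0
  · rw [← h0, Real.zero_rpow hp.ne']
    positivity
  have h1 := H #T (by simpa using card_le_univ T)
    (fun j => ‖w i‖⁻¹ • w (T.orderEmbOfFin rfl j)) fun j => by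
      rw [norm_smul, norm_inv, norm_norm, inv_mul_eq_div, le_div_iff₀ h0, one_mul]
      exact hmin _ (orderEmbOfFin_mem T rfl j)
  rw [radSq_smul, Real.sqrt_mul (sq_nonneg _), Real.sqrt_sq (by positivity)] at h1
  have h2 : √(radSq fun j => w (T.orderEmbOfFin rfl j)) ≤ √(radSq w) :=
    Real.sqrt_le_sqrt (radSq_comp_le (T.orderEmbOfFin rfl).injective w)
  have h3 : ‖w i‖ * (#T : ℝ) ^ γ ≤ B * √(radSq w) := by
    calc ‖w i‖ * (#T : ℝ) ^ γ
        ≤ ‖w i‖ * (B * (‖w i‖⁻¹ * √(radSq fun j => w (T.orderEmbOfFin rfl j)))) := by gcongr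
      _ = B * √(radSq fun j => w (T.orderEmbOfFin rfl j)) := by field_simp
      _ ≤ _ := by gcongr
  calc ‖w i‖ ^ p = (‖w i‖ * (#T : ℝ) ^ γ) ^ p * (#T : ℝ) ^ (-(γ * p)) := by
        rw [Real.mul_rpow h0.le (by positivity), mul_assoc, ← Real.rpow_mul hc.le,
          ← Real.rpow_add hc]
        simp
    _ ≤ _ := by gcongr

end Cotype

section Cotype

open Finset
open scoped BigOperators

variable {Y : Type*} [NormedAddCommGroup Y] [NormedSpace ℝ Y]

/-- The inductive step for lower bounds of Rademacher averages. -/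
lemma rpow_le_mul_sqrt_radSq_step {p γ K B : ℝ} (hp : 0 < p) (hγ : 0 < γ) (hγ2 : γ < 1 / 2)
    (hK : 0 < K) (hB : 1 ≤ B)
    (hD : ∀ (n : ℕ) (x : Fin n → Y) (M : ℝ),
      (∀ a : Fin n → ℝ, (∀ i, |a i| ≤ 1) → ‖∑ i, a i • x i‖ ≤ M) → ∑ i, ‖x i‖ ^ p ≤ K * M ^ p)
    {k N : ℕ} (hk : 1 ≤ k) (hN : 1 ≤ N) (hkN : (k : ℝ) ≤ (N : ℝ) ^ (1 - 2 * γ))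
    (hk2 : (1 + 2 / √(1 - 2 * γ)) * 2 ^ γ * K ^ (1 / p) ≤ (k : ℝ) ^ (1 / p - γ))
    (H : ∀ n ≤ N, ∀ x : Fin n → Y, (∀ i, 1 ≤ ‖x i‖) → (n : ℝ) ^ γ ≤ B * √(radSq x))
    {n : ℕ} (hn1 : k * N ≤ n) (hn2 : n ≤ 2 * k * N) (x : Fin n → Y) (hx : ∀ i, 1 ≤ ‖x i‖) :
    (n : ℝ) ^ γ ≤ B * √(radSq x) := by
  have : NeZero N := ⟨by omega⟩
  have hu : 0 < 1 - 2 * γ := by linarith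
  have hNr : (0 : ℝ) < N := by exact_mod_cast hN
  have hkr : (0 : ℝ) < k := by exact_mod_cast hk
  set R := √(radSq x) with hR
  have hR0 : 0 ≤ R := Real.sqrt_nonneg _
  let e : Fin k × Fin N → Fin n := fun p => Fin.castLE hn1 (finProdFinEquiv p)
  have he : Function.Injective e :=
    (Fin.castLE_injective hn1).comp finProdFinEquiv.injective
  have hRe : √(radSq fun p : Fin k × Fin N => x (e p)) ≤ R :=
    Real.sqrt_le_sqrt (radSq_comp_le he x)
  have hC : ∀ w : Fin N → Y, ∑ i, ‖w i‖ ^ 2 ≤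
      (B ^ 2 * ((N : ℝ) ^ (1 - 2 * γ) / (1 - 2 * γ))) * radSq w := by
    intro w
    have h1 := sum_norm_rpow_le (p := 2) (by norm_num) (by linarith) H w
    have h2 := sum_range_rpow_sub_one_le hu (by linarith) N
    have h3 : (1 - 2 * γ) - 1 = -(γ * 2) := by ring
    rw [h3] at h2
    have h4 : (B * √(radSq w)) ^ (2 : ℝ) = B ^ 2 * radSq w := by
      rw [Real.rpow_two, mul_pow, Real.sq_sqrt (radSq_nonneg w)]
    rw [h4] at h1
    simp only [Real.rpow_two] at h1
    refine h1.trans ?_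
    have := mul_le_mul_of_nonneg_left h2 (mul_nonneg (sq_nonneg B) (radSq_nonneg w))
    linarith
  have h1 : 𝔼 a : Fin k → Fin N, weakSum (fun l => x (e (l, a l))) ≤
      R * (N : ℝ) ^ (-γ) * (B * (1 + 2 / √(1 - 2 * γ))) := by
    have h2 := expect_weakSum_le fun (l : Fin k) (i : Fin N) => x (e (l, i))
    have h3 := expect_radSq_le hC fun (l : Fin k) (i : Fin N) => x (e (l, i))
    simp only [Fintype.card_fin] at h2 h3
    have h4 : √(k / N) ≤ (N : ℝ) ^ (-γ) := by
      apply Real.sqrt_le_iff.mpr ⟨by positivity, ?_⟩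
      rw [div_le_iff₀ hNr]
      refine hkN.trans (le_of_eq ?_)
      rw [← Real.rpow_mul_natCast hNr.le, ← Real.rpow_add_one hNr.ne']
      congr 1
      push_cast
      ring
    have h5 : √(B ^ 2 * ((N : ℝ) ^ (1 - 2 * γ) / (1 - 2 * γ)) / N) =
        B * (N : ℝ) ^ (-γ) / √(1 - 2 * γ) := by
      have : B ^ 2 * ((N : ℝ) ^ (1 - 2 * γ) / (1 - 2 * γ)) / N =
          (B * (N : ℝ) ^ (-γ)) ^ 2 / (1 - 2 * γ) := by
        rw [mul_pow, ← Real.rpow_mul_natCast hNr.le, show 1 - 2 * γ = -γ * (2 : ℕ) + 1 by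
          push_cast; ring, Real.rpow_add_one hNr.ne']
        field_simp
      rw [this, Real.sqrt_div (sq_nonneg _), Real.sqrt_sq (by positivity)]
    have h6 : √(𝔼 a : Fin k → Fin N, radSq fun l => x (e (l, a l))) ≤
        B * (N : ℝ) ^ (-γ) / √(1 - 2 * γ) * R := by
      refine (Real.sqrt_le_sqrt h3).trans ?_
      rw [Real.sqrt_mul (by positivity), h5]
      gcongr
    calc _ ≤ _ := h2
      _ ≤ (N : ℝ) ^ (-γ) * R + 2 * (B * (N : ℝ) ^ (-γ) / √(1 - 2 * γ) * R) := by gcongr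
      _ ≤ B * ((N : ℝ) ^ (-γ) * R) + 2 * (B * (N : ℝ) ^ (-γ) / √(1 - 2 * γ) * R) := by
        exact add_le_add_left (le_mul_of_one_le_left (by positivity) hB) _
      _ = _ := by ring
  have h2 : ∀ a : Fin k → Fin N, (k / K) ^ (1 / p) ≤ weakSum (fun l => x (e (l, a l))) := by
    intro a
    have hw : 0 ≤ weakSum (fun l => x (e (l, a l))) :=
      (norm_nonneg _).trans (norm_sum_smul_le_weakSum (fun l => x (e (l, a l))) 0 (by simp))
    have h3 := hD k (fun l => x (e (l, a l))) _ (norm_sum_smul_le_weakSum _)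
    have h4 : (k : ℝ) ≤ ∑ l, ‖x (e (l, a l))‖ ^ p := by
      calc (k : ℝ) = ∑ l : Fin k, (1 : ℝ) := by simp
        _ ≤ _ := sum_le_sum fun l _ => Real.one_le_rpow (hx _) hp.le
    rw [one_div, Real.rpow_inv_le_iff_of_pos (by positivity) hw hp, div_le_iff₀ hK]
    linarith
  have h3 : (k / K) ^ (1 / p) ≤ R * (N : ℝ) ^ (-γ) * (B * (1 + 2 / √(1 - 2 * γ))) := by
    refine le_trans ?_ h1
    have := expect_le_expect (s := (univ : Finset (Fin k → Fin N))) fun a _ => h2 a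
    simpa [Fintype.expect_const] using this
  have hc : 0 < 1 + 2 / √(1 - 2 * γ) := by positivity
  rw [Real.rpow_sub hkr, le_div_iff₀ (by positivity)] at hk2
  rw [Real.div_rpow hkr.le hK.le, div_le_iff₀ (by positivity)] at h3
  have h4 : (n : ℝ) ^ γ ≤ 2 ^ γ * (k : ℝ) ^ γ * (N : ℝ) ^ γ := by
    rw [← Real.mul_rpow (by norm_num) hkr.le, ← Real.mul_rpow (by positivity) hNr.le]
    exact Real.rpow_le_rpow (by positivity) (by exact_mod_cast hn2) hγ.le
  have h5 : (1 + 2 / √(1 - 2 * γ)) * K ^ (1 / p) * (2 ^ γ * (k : ℝ) ^ γ) ≤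
      (1 + 2 / √(1 - 2 * γ)) * K ^ (1 / p) * (R * (N : ℝ) ^ (-γ) * B) := by linarith
  have h6 := le_of_mul_le_mul_left h5 (by positivity)
  calc (n : ℝ) ^ γ ≤ 2 ^ γ * (k : ℝ) ^ γ * (N : ℝ) ^ γ := h4
    _ ≤ R * (N : ℝ) ^ (-γ) * B * (N : ℝ) ^ γ := by gcongr
    _ = B * R := by
      rw [Real.rpow_neg hNr.le]
      field_simp

lemma exists_rpow_le_mul_sqrt_radSq {p γ : ℝ} (hp : 0 < p) (hγ : 0 < γ) (hγ2 : γ < 1 / 2)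
    (hγp : γ < 1 / p) (hD : HasOrlicz Y p) :
    ∃ B, 1 ≤ B ∧ ∀ (n : ℕ) (x : Fin n → Y), (∀ i, 1 ≤ ‖x i‖) → (n : ℝ) ^ γ ≤ B * √(radSq x) := by
  obtain ⟨K₀, hD⟩ := hD
  have hK : 0 < max K₀ 1 := by positivity
  replace hD : ∀ (n : ℕ) (x : Fin n → Y) (M : ℝ),
      (∀ a : Fin n → ℝ, (∀ i, |a i| ≤ 1) → ‖∑ i, a i • x i‖ ≤ M) →
      ∑ i, ‖x i‖ ^ p ≤ max K₀ 1 * M ^ p := fun n x M h =>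
    (hD n x M h).trans (mul_le_mul_of_nonneg_right (le_max_left _ _)
      (Real.rpow_nonneg ((norm_nonneg _).trans (h 0 (by simp))) _))
  have hu : 0 < 1 - 2 * γ := by linarith
  obtain ⟨k, hk, hk2⟩ := ((((tendsto_rpow_atTop (y := 1 / p - γ) (by linarith)).comp
    tendsto_natCast_atTop_atTop).eventually_ge_atTop
      ((1 + 2 / √(1 - 2 * γ)) * 2 ^ γ * (max K₀ 1) ^ (1 / p))).and
        (Filter.eventually_ge_atTop 2)).exists
  obtain ⟨N₀, hN₀, hN₁⟩ := ((((tendsto_rpow_atTop hu).comp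
    tendsto_natCast_atTop_atTop).eventually_ge_atTop (k : ℝ)).and
        (Filter.eventually_ge_atTop 1)).exists
  simp only [Function.comp_apply] at hk hN₀
  refine ⟨max 1 (((k * N₀ : ℕ) : ℝ) ^ γ), le_max_left _ _, fun n => ?_⟩
  induction n using Nat.strong_induction_on with
  | _ n ih =>
    intro x hx
    rcases lt_or_ge n (k * N₀) with h | h
    · rcases Nat.eq_zero_or_pos n with h0 | h0
      · subst h0
        rw [Nat.cast_zero, Real.zero_rpow hγ.ne']
        positivity
      have h1 : 1 ≤ √(radSq x) := by
        rw [Real.one_le_sqrt]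
        refine le_trans ?_ (radSq_comp_le (e := fun _ : Unit => (⟨0, h0⟩ : Fin n))
          (Function.injective_of_subsingleton _) x)
        unfold radSq
        have h2 : ∀ ε : Unit → Bool,
            ‖∑ i, boolSign (ε i) • (x ∘ fun _ : Unit => (⟨0, h0⟩ : Fin n)) i‖ ^ 2 =
              ‖x ⟨0, h0⟩‖ ^ 2 := by
          intro ε
          simp [norm_smul, abs_boolSign]
        simp only [h2, Fintype.expect_const]
        exact one_le_pow₀ (hx _)
      calc (n : ℝ) ^ γ ≤ ((k * N₀ : ℕ) : ℝ) ^ γ := by gcongr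
        _ ≤ max 1 (((k * N₀ : ℕ) : ℝ) ^ γ) := le_max_right _ _
        _ ≤ _ := le_mul_of_one_le_right (by positivity) h1
    · have hkpos : 0 < k := by omega
      have hN : N₀ ≤ n / k := by rw [Nat.le_div_iff_mul_le hkpos]; linarith
      have hlt : n / k < n := Nat.div_lt_self (by nlinarith) (by omega)
      have hm := Nat.div_add_mod n k
      have hm' := Nat.mod_lt n hkpos
      refine rpow_le_mul_sqrt_radSq_step (k := k) (N := n / k) hp hγ hγ2 hK (le_max_left _ _) hD
        (by omega) (by omega) ?_ hk (fun n' hn' => ih n' (by omega)) (Nat.mul_div_le n k) ?_ x hx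
      · refine hN₀.trans ?_
        gcongr
      · nlinarith

lemma hasCotype_of_hasOrlicz {p s : ℝ} (hp : 2 ≤ p) (hps : p < s) (hD : HasOrlicz Y p) :
    HasCotype Y s := by
  have hp0 : 0 < p := by linarith
  have hs0 : 0 < s := by linarith
  obtain ⟨γ, hγ1, hγ2⟩ := exists_between (one_div_lt_one_div_of_lt hp0 hps)
  have hγ0 : 0 < γ := lt_trans (by positivity) hγ1
  have hp2 : 1 / p ≤ 1 / 2 := one_div_le_one_div_of_le (by norm_num) hp
  obtain ⟨B, hB, H⟩ := exists_rpow_le_mul_sqrt_radSq hp0 hγ0 (by linarith) hγ2 hD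
  have hγs : 1 < γ * s := by rwa [div_lt_iff₀ hs0] at hγ1
  have hsum : Summable fun l : ℕ => ((l + 1 : ℕ) : ℝ) ^ (-(γ * s)) :=
    (summable_nat_add_iff 1).mpr (Real.summable_nat_rpow.mpr (by linarith))
  set Z := ∑' l : ℕ, ((l + 1 : ℕ) : ℝ) ^ (-(γ * s)) with hZ
  have hZ0 : 0 ≤ Z := tsum_nonneg fun l => by positivity
  refine ⟨B * Z ^ (1 / s), by positivity, fun k x => ?_⟩
  have h1 := sum_norm_rpow_le hs0 (by linarith) (fun n _ => H n) x (γ := γ) (B := B)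
  have h2 : (2 ^ k : ℝ)⁻¹ * ∑ ε : Fin k → Bool, ‖∑ j, (if ε j then x j else -x j)‖ ^ 2 =
      radSq x := by
    unfold radSq
    rw [Fintype.expect_eq_sum_div_card, div_eq_inv_mul]
    simp only [Fintype.card_pi, Fintype.card_bool, prod_const, card_univ, Fintype.card_fin]
    push_cast
    congr 1
    refine sum_congr rfl fun ε _ => ?_
    congr 2
    refine sum_congr rfl fun j _ => ?_
    cases h : ε j <;> simp [boolSign]
  rw [h2, one_div, Real.rpow_inv_le_iff_of_pos (by positivity) (by positivity) hs0]
  refine h1.trans ?_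
  have h3 : (B * Z ^ s⁻¹ * √(radSq x)) ^ s = (B * √(radSq x)) ^ s * Z := by
    rw [show B * Z ^ s⁻¹ * √(radSq x) = B * √(radSq x) * Z ^ s⁻¹ by ring,
      Real.mul_rpow (by positivity) (by positivity), Real.rpow_inv_rpow hZ0 hs0.ne']
  rw [h3]
  gcongr
  exact hsum.sum_le_tsum _ fun _ _ => by positivity

end Cotype

section DvoretzkyRogers

open Finset

variable {Y : Type*} [NormedAddCommGroup Y] [NormedSpace ℝ Y]

lemma nonneg_of_hasDerivAt_of_nonneg {f : ℝ → ℝ} {d : ℝ} (hf : HasDerivAt f d 0) (h0 : f 0 = 0)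
    (h : ∀ t, 0 < t → 0 ≤ f t) : 0 ≤ d := by
  refine ge_of_tendsto hf.tendsto_slope_zero_right ?_
  filter_upwards [self_mem_nhdsWithin] with t ht
  have ht : 0 < t := ht
  simp only [zero_add, h0, sub_zero, smul_eq_mul]
  exact mul_nonneg (by positivity) (h t ht)

/-- If `det (1 + t P) ≤ (1 + a t) ^ N` for small `t > 0`, then `tr P ≤ N a`. -/
lemma trace_le_of_det_one_add_smul_le {E : Type*} [AddCommGroup E] [Module ℝ E]
    [FiniteDimensional ℝ E] (P : E →ₗ[ℝ] E) {a : ℝ} {N : ℕ}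
    (h : ∀ t : ℝ, 0 < t → LinearMap.det (1 + t • P) ≤ (1 + t * a) ^ N) :
    LinearMap.trace ℝ E P ≤ N * a := by
  let b := Module.finBasis ℝ E
  let M := LinearMap.toMatrix b b P
  have hdet : ∀ t : ℝ, LinearMap.det (1 + t • P) = (1 + t • M).det := by
    intro t
    rw [← LinearMap.det_toMatrix b]
    simp [M, LinearMap.toMatrix_one]
  have htr : LinearMap.trace ℝ E P = M.trace := LinearMap.trace_eq_matrix_trace ℝ b P
  rw [htr, ← sub_nonneg]
  set Q : Polynomial ℝ := (Matrix.det (1 + (Polynomial.X : Polynomial ℝ) •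
    M.map Polynomial.C)).divX.divX with hQ
  have h1 : HasDerivAt (fun t : ℝ => (1 + t * a) ^ N) (N * a) 0 := by
    have := (((hasDerivAt_id (0 : ℝ)).mul_const a).const_add 1).fun_pow N
    simpa using this
  have h2 : HasDerivAt (fun t : ℝ => 1 + M.trace * t + Q.eval t * t ^ 2) M.trace 0 := by
    have := (((hasDerivAt_id (0 : ℝ)).const_mul M.trace).const_add 1).add
      ((Q.hasDerivAt 0).mul ((hasDerivAt_id (0 : ℝ)).fun_pow 2))
    simp only [id_eq, mul_one, Nat.cast_ofNat, ne_eq, OfNat.ofNat_ne_zero, not_false_eq_true,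
      zero_pow, mul_zero, Nat.add_one_sub_one, pow_one, add_zero] at this
    exact this
  refine nonneg_of_hasDerivAt_of_nonneg (h1.sub h2) (by simp) fun t ht => ?_
  have h3 := h t ht
  rw [hdet, Matrix.det_one_add_smul] at h3
  simpa using h3

/-- A linear injection from a Euclidean space can be renormalised by a map of maximal
determinant. -/
lemma exists_finrank_le_mul_norm_comp {E : Type*} [NormedAddCommGroup E] [InnerProductSpace ℝ E]
    [FiniteDimensional ℝ E] (W : E →L[ℝ] Y) (hW : Function.Injective W) :
    ∃ V : E →L[ℝ] Y, ‖V‖ ≤ 1 ∧ ∀ F : Submodule ℝ E,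
      (Module.finrank ℝ F : ℝ) ≤ Module.finrank ℝ E * ‖V.comp F.starProjection‖ := by
  obtain ⟨c, hc⟩ := (LinearMap.injective_iff_antilipschitz (f := W.toLinearMap)).mp hW
  obtain ⟨hc0, hc⟩ := hc
  have hWb : ∀ v, ‖v‖ ≤ c * ‖W v‖ := fun v => by simpa using hc.le_mul_dist v 0
  let S : Set (E →L[ℝ] E) := {u | ‖W.comp u‖ ≤ 1}
  have hSc : IsCompact S := by
    refine Metric.isCompact_of_isClosed_isBounded ?_ ?_
    · refine isClosed_le ?_ continuous_const
      exact ((ContinuousLinearMap.compL ℝ E E Y W).continuous).norm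
    · refine isBounded_iff_forall_norm_le.mpr ⟨c, fun u hu => ?_⟩
      refine u.opNorm_le_bound c.coe_nonneg fun v => (hWb _).trans ?_
      gcongr
      simpa using (W.comp u).le_of_opNorm_le hu v
  obtain ⟨u, huS, hmax⟩ := hSc.exists_isMaxOn ⟨0, by simp [S]⟩
    (ContinuousLinearMap.continuous_det (𝕜 := ℝ) (E := E)).continuousOn
  have hpos : 0 < u.det := by
    let δ : ℝ := (‖W‖ + 1)⁻¹
    have hδ : 0 < δ := by positivity
    have h1 : δ • ContinuousLinearMap.id ℝ E ∈ S := by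
      change ‖W.comp (δ • ContinuousLinearMap.id ℝ E)‖ ≤ 1
      rw [ContinuousLinearMap.comp_smul, norm_smul, ContinuousLinearMap.comp_id,
        Real.norm_of_nonneg hδ.le, inv_mul_le_iff₀ (by positivity)]
      linarith
    refine lt_of_lt_of_le ?_ (hmax h1)
    change 0 < LinearMap.det (δ • (LinearMap.id : E →ₗ[ℝ] E))
    rw [LinearMap.det_smul]
    simp only [LinearMap.det_id, mul_one]
    positivity
  refine ⟨W.comp u, huS, fun F => ?_⟩
  set a := ‖(W.comp u).comp F.starProjection‖ with ha
  have htr : LinearMap.trace ℝ E (F.starProjection : E →ₗ[ℝ] E) = Module.finrank ℝ F := by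
    refine LinearMap.IsProj.trace (p := F) ⟨fun x => ?_, fun x hx => ?_⟩
    · exact F.starProjection_apply_mem x
    · exact Submodule.starProjection_eq_self_iff.mpr hx
  rw [← htr]
  refine trace_le_of_det_one_add_smul_le _ fun t ht => ?_
  have hta : 0 < 1 + t * a := by positivity
  have h1 : (1 + t * a)⁻¹ • (u.comp (1 + t • F.starProjection)) ∈ S := by
    change ‖W.comp ((1 + t * a)⁻¹ • (u.comp (1 + t • F.starProjection)))‖ ≤ 1
    rw [ContinuousLinearMap.comp_smul, norm_smul, norm_inv, Real.norm_of_nonneg hta.le,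
      inv_mul_le_iff₀ hta, mul_one]
    have : W.comp (u.comp (1 + t • F.starProjection)) =
        W.comp u + t • (W.comp u).comp F.starProjection := by
      ext v; simp
    rw [this]
    refine (norm_add_le _ _).trans (add_le_add huS ?_)
    rw [norm_smul, Real.norm_of_nonneg ht.le]
  have h2 : ContinuousLinearMap.det _ ≤ u.det := hmax h1
  have h3 : ((1 + t * a)⁻¹ • (u.comp (1 + t • F.starProjection))).det =
      ((1 + t * a)⁻¹) ^ Module.finrank ℝ E * (u.det *
        LinearMap.det (1 + t • (F.starProjection : E →ₗ[ℝ] E))) := by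
    change LinearMap.det ((1 + t * a)⁻¹ • ((u : E →ₗ[ℝ] E) ∘ₗ
      (1 + t • (F.starProjection : E →ₗ[ℝ] E)))) = _
    rw [LinearMap.det_smul, LinearMap.det_comp]
  rw [h3,  inv_pow, inv_mul_le_iff₀ (by positivity), mul_comm] at h2
  exact le_of_mul_le_mul_right h2 hpos

lemma exists_orthonormal_norm_ge {E : Type*} [NormedAddCommGroup E] [InnerProductSpace ℝ E]
    [FiniteDimensional ℝ E] {n : ℕ} (hE : Module.finrank ℝ E = 2 * n) (V : E →L[ℝ] Y)
    (hV : ∀ F : Submodule ℝ E,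
      (Module.finrank ℝ F : ℝ) ≤ Module.finrank ℝ E * ‖V.comp F.starProjection‖) :
    ∀ j ≤ n, ∃ v : Fin j → E, Orthonormal ℝ v ∧ ∀ i, 1 / 4 ≤ ‖V (v i)‖ := by
  intro j
  induction j with
  | zero => exact fun _ => ⟨Fin.elim0, ⟨fun i => i.elim0, fun i => i.elim0⟩, fun i => i.elim0⟩
  | succ j ih =>
    intro hj
    obtain ⟨v, hv, hVv⟩ := ih (by omega)
    set F := (Submodule.span ℝ (Set.range v))ᗮ with hF
    have hdim : n ≤ Module.finrank ℝ F := by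
      have h1 := Submodule.finrank_add_finrank_orthogonal (Submodule.span ℝ (Set.range v))
      have h2 := finrank_span_eq_card hv.linearIndependent
      rw [Fintype.card_fin] at h2
      rw [← hF] at h1
      omega
    have hnr : (0 : ℝ) < n := by exact_mod_cast (by omega : 0 < n)
    have ha : 1 / 2 ≤ ‖V.comp F.starProjection‖ := by
      have h1 := hV F
      have h2 : (n : ℝ) ≤ Module.finrank ℝ F := by exact_mod_cast hdim
      rw [hE] at h1
      push_cast at h1
      by_contra! h3
      nlinarith
    obtain ⟨z, hz⟩ : ∃ z, 1 / 4 * ‖z‖ < ‖V (F.starProjection z)‖ := by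
      by_contra! h
      have := (V.comp F.starProjection).opNorm_le_bound (by norm_num) h
      linarith
    set w := F.starProjection z with hw
    have hwF : w ∈ F := F.starProjection_apply_mem z
    have hw0 : 0 < ‖w‖ := by
      rw [norm_pos_iff]
      intro h
      rw [h, map_zero, norm_zero] at hz
      linarith [norm_nonneg z]
    have hwz : ‖w‖ ≤ ‖z‖ := by
      simpa using F.starProjection.le_of_opNorm_le F.starProjection_norm_le z
    have hvw : ∀ i, inner ℝ (v i) w = 0 := fun i =>
      Submodule.inner_right_of_mem_orthogonal (Submodule.subset_span (Set.mem_range_self i)) hwF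
    have hwv : ∀ i, inner ℝ w (v i) = 0 := fun i => by rw [real_inner_comm]; exact hvw i
    refine ⟨Fin.snoc v (‖w‖⁻¹ • w), ?_, ?_⟩
    · rw [orthonormal_iff_ite] at hv ⊢
      intro i i'
      induction i using Fin.lastCases with
      | last =>
        induction i' using Fin.lastCases with
        | last =>
          simp [norm_smul, hw0.ne']
        | cast i' =>
          have : Fin.last j ≠ i'.castSucc := (Fin.castSucc_lt_last i').ne'
          simp [real_inner_smul_left, hwv, this]
      | cast i =>
        induction i' using Fin.lastCases with
        | last =>
          have : i.castSucc ≠ Fin.last j := (Fin.castSucc_lt_last i).ne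
          simp [real_inner_smul_right, hvw, this]
        | cast i' => simpa using hv i i'
    · intro i
      induction i using Fin.lastCases with
      | last =>
        simp only [Fin.snoc_last, map_smul, norm_smul, norm_inv, norm_norm]
        rw [inv_mul_eq_div, le_div_iff₀ hw0]
        nlinarith
      | cast i => simpa using hVv i

/-- A weak form of the Dvoretzky–Rogers lemma. -/
lemma exists_norm_sum_smul_le_sqrt (hY : ¬FiniteDimensional ℝ Y) (n : ℕ) :
    ∃ x : Fin n → Y, (∀ i, 1 / 4 ≤ ‖x i‖) ∧
      ∀ b : Fin n → ℝ, ‖∑ i, b i • x i‖ ≤ √(∑ i, b i ^ 2) := by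
  obtain ⟨w, hw⟩ : ∃ w : Fin (2 * n) → Y, LinearIndependent ℝ w :=
    exists_linearIndependent_of_le_rank
      ((Cardinal.natCast_lt_aleph0).le.trans (by
        rw [← not_lt, Module.rank_lt_aleph0_iff]; exact hY))
  let E := EuclideanSpace ℝ (Fin (2 * n))
  let W : E →ₗ[ℝ] Y := (Fintype.linearCombination ℝ w) ∘ₗ
    (WithLp.linearEquiv 2 ℝ (Fin (2 * n) → ℝ)).toLinearMap
  have hWi : Function.Injective W :=
    (linearIndependent_iff_injective_fintypeLinearCombination.mp hw).comp (WithLp.linearEquiv 2 ℝ _).injective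
  obtain ⟨V, hV1, hV⟩ := exists_finrank_le_mul_norm_comp (LinearMap.toContinuousLinearMap W) hWi
  obtain ⟨v, hv, hVv⟩ := exists_orthonormal_norm_ge (n := n) (by simp [E]) V hV n le_rfl
  refine ⟨fun i => V (v i), hVv, fun b => ?_⟩
  have h1 : ∑ i, b i • V (v i) = V (∑ i, b i • v i) := by simp [map_sum]
  have h2 : ‖∑ i, b i • v i‖ = √(∑ i, b i ^ 2) := by
    rw [norm_eq_sqrt_real_inner, hv.inner_sum]
    simp [sq]
  rw [h1, ← h2]
  simpa using V.le_of_opNorm_le hV1 (∑ i, b i • v i)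

end DvoretzkyRogers

section Extrapolation

open Finset

variable {Y : Type*} [NormedAddCommGroup Y] [NormedSpace ℝ Y]

/-- Dyadic decomposition of the coefficients of a linear combination. -/
lemma norm_sum_smul_le_of_levels {ι : Type*} {G : Finset ι} {x : ι → Y} {p : ι → ℝ}
    {V s lam : ℝ} (hs : 1 ≤ s) (hsl : s < lam) (hV : 0 < V) (hp : ∀ i ∈ G, 0 ≤ p i)
    (h1 : ∀ S ⊆ G, ∀ a : ι → ℝ, (∀ i ∈ S, |a i| ≤ 1) → ‖∑ i ∈ S, a i • x i‖ ≤ 1)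
    (h2 : ∀ S ⊆ G, ∀ a : ι → ℝ, (∀ i ∈ S, |a i| ≤ 1) →
      ‖∑ i ∈ S, a i • x i‖ ^ s ≤ 2 * V * ∑ i ∈ S, p i)
    (a : ι → ℝ) (ha : ∑ i ∈ G, |a i| ^ lam * p i ≤ 1) :
    ‖∑ i ∈ G, a i • x i‖ ≤ V ^ (1 / lam) * (1 + 4 / (1 - 2 ^ (1 - lam / s))) := by
  have hs0 : 0 < s := by linarith
  have hl0 : 0 < lam := by linarith
  set r : ℝ := 2 ^ (1 - lam / s) with hr
  have hr0 : 0 < r := by positivity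
  have hr1 : r < 1 := Real.rpow_lt_one_of_one_lt_of_neg (by norm_num)
    (by rw [sub_neg, one_lt_div hs0]; exact hsl)
  set H := V ^ (1 / lam) with hH
  have hH0 : 0 < H := by positivity
  have hHV : H ^ lam = V := by rw [hH, one_div, Real.rpow_inv_rpow hV.le hl0.ne']
  have scale : ∀ (S : Finset ι) (h : ℝ), 0 < h →
      ‖∑ i ∈ S, a i • x i‖ = h * ‖∑ i ∈ S, (a i / h) • x i‖ := by
    intro S h hh
    have : ∑ i ∈ S, a i • x i = h • ∑ i ∈ S, (a i / h) • x i := by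
      rw [smul_sum]
      refine sum_congr rfl fun i _ => ?_
      rw [smul_smul, mul_div_cancel₀ _ hh.ne']
    rw [this, norm_smul, Real.norm_of_nonneg hh.le]
  have key : ∀ (L : ℕ), ∀ S ⊆ G, (∀ i ∈ S, |a i| ≤ H * 2 ^ L) →
      ‖∑ i ∈ S, a i • x i‖ ≤ H * (1 + 4 * ∑ l ∈ range L, r ^ l) := by
    intro L
    induction L with
    | zero =>
      intro S hS hSa
      rw [scale S H hH0]
      simp only [range_zero, sum_empty, mul_zero, add_zero]
      gcongr
      refine h1 S hS _ fun i hi => ?_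
      rw [abs_div, abs_of_pos hH0, div_le_one hH0]
      simpa using hSa i hi
    | succ L ih =>
      intro S hS hSa
      classical
      rw [← sum_filter_add_sum_filter_not S (fun i => |a i| ≤ H * 2 ^ L)]
      refine (norm_add_le _ _).trans ?_
      have h3 := ih (S.filter fun i => |a i| ≤ H * 2 ^ L) ((filter_subset _ _).trans hS)
        fun i hi => (mem_filter.mp hi).2
      set S' := S.filter fun i => ¬|a i| ≤ H * 2 ^ L with hS'
      have hS'G : S' ⊆ G := (filter_subset _ _).trans hS
      have hh : 0 < H * 2 ^ (L + 1) := by positivity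
      have h4 := h2 S' hS'G (fun i => a i / (H * 2 ^ (L + 1))) fun i hi => by
        rw [abs_div, abs_of_pos hh, div_le_one hh]
        exact hSa i (filter_subset _ _ hi)
      have h5 : (H * 2 ^ L) ^ lam * ∑ i ∈ S', p i ≤ 1 := by
        rw [mul_sum]
        refine le_trans (sum_le_sum fun i hi => ?_)
          ((sum_le_sum_of_subset_of_nonneg hS'G fun i hi _ =>
            mul_nonneg (by positivity) (hp i hi)).trans ha)
        have := not_le.mp (mem_filter.mp hi).2
        exact mul_le_mul_of_nonneg_right (Real.rpow_le_rpow (by positivity) this.le hl0.le)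
          (hp i (hS'G hi))
      have h6 : 2 * V * ∑ i ∈ S', p i ≤ (2 * r ^ L / 2 ^ L) ^ s := by
        have e1 : (r ^ L / 2 ^ L) ^ s = ((2 ^ L : ℝ) ^ lam)⁻¹ := by
          have e2 : r ^ L / 2 ^ L = (2 : ℝ) ^ (-(lam / s) * L) := by
            rw [hr, ← Real.rpow_mul_natCast (by norm_num), ← Real.rpow_natCast 2 L,
              ← Real.rpow_sub (by norm_num)]
            congr 1; ring
          rw [e2, ← Real.rpow_mul (by norm_num), ← Real.rpow_natCast 2 L,
            ← Real.rpow_mul (by norm_num), ← Real.rpow_neg (by norm_num)]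
          congr 1
          field_simp
        rw [mul_div_assoc, Real.mul_rpow (by norm_num) (by positivity), e1]
        rw [Real.mul_rpow hH0.le (by positivity), hHV, mul_comm V, mul_assoc] at h5
        have e3 : V * ∑ i ∈ S', p i ≤ ((2 ^ L : ℝ) ^ lam)⁻¹ := by
          rw [← one_div, le_div_iff₀ (by positivity)]; linarith
        have e4 : (2 : ℝ) ≤ 2 ^ s := by
          simpa using Real.rpow_le_rpow_of_exponent_le (x := 2) (by norm_num) hs
        rw [mul_assoc]
        gcongr
        refine mul_nonneg hV.le (sum_nonneg fun i hi => hp i (hS'G hi))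
      have h7 := (Real.rpow_le_rpow_iff (norm_nonneg _) (by positivity) hs0).mp (h4.trans h6)
      rw [scale S' _ hh]
      have h8 : H * 2 ^ (L + 1) * ‖∑ i ∈ S', (a i / (H * 2 ^ (L + 1))) • x i‖ ≤
          H * (4 * r ^ L) := by
        calc _ ≤ H * 2 ^ (L + 1) * (2 * r ^ L / 2 ^ L) := by gcongr
          _ = _ := by rw [pow_succ]; field_simp; ring
      rw [sum_range_succ]
      linarith
  obtain ⟨L, hL⟩ : ∃ L : ℕ, ∀ i ∈ G, |a i| ≤ H * 2 ^ L := by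
    obtain ⟨L, hL⟩ := pow_unbounded_of_one_lt ((∑ i ∈ G, |a i|) / H) (one_lt_two (α := ℝ))
    refine ⟨L, fun i hi => ?_⟩
    rw [div_lt_iff₀ hH0, mul_comm] at hL
    exact (single_le_sum (f := fun i => |a i|) (fun i _ => abs_nonneg _) hi).trans hL.le
  refine (key L G Subset.rfl hL).trans ?_
  gcongr
  rw [div_eq_mul_inv]
  gcongr
  rw [← tsum_geometric_of_lt_one hr0.le hr1]
  exact (summable_geometric_of_lt_one hr0.le hr1).sum_le_tsum _ fun _ _ => by positivity

/-- Nearly extremal families: blocks are controlled by the sum of the `s`-th powers. -/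
lemma exists_nearly_extremal {s : ℝ} (hs : 0 < s) {n : ℕ} (hn : 0 < n) (x₀ : Fin n → Y)
    (hx₀ : ∀ a : Fin n → ℝ, (∀ i, |a i| ≤ 1) → ‖∑ i, a i • x₀ i‖ ≤ 1)
    (h0 : 0 < ∑ i, ‖x₀ i‖ ^ s) :
    ∃ x : Fin n → Y, (∀ a : Fin n → ℝ, (∀ i, |a i| ≤ 1) → ‖∑ i, a i • x i‖ ≤ 1) ∧
      2 / 3 * ∑ i, ‖x₀ i‖ ^ s ≤ ∑ i, ‖x i‖ ^ s ∧
      ∀ (S : Finset (Fin n)) (a : Fin n → ℝ), (∀ i ∈ S, |a i| ≤ 1) → S.Nonempty →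
        ‖∑ i ∈ S, a i • x i‖ ^ s ≤ ∑ i ∈ S, ‖x i‖ ^ s + (∑ i, ‖x i‖ ^ s) / (2 * n) := by
  classical
  have hnr : (1 : ℝ) ≤ n := by exact_mod_cast hn
  let A : Set ℝ := {v | ∃ x : Fin n → Y,
    (∀ a : Fin n → ℝ, (∀ i, |a i| ≤ 1) → ‖∑ i, a i • x i‖ ≤ 1) ∧ v = ∑ i, ‖x i‖ ^ s}
  have hA : BddAbove A := by
    refine ⟨n, ?_⟩
    rintro _ ⟨x, hx, rfl⟩
    have h1 : ∀ i, ‖x i‖ ≤ 1 := by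
      intro i
      have := hx (Pi.single i 1) fun j => by
        rcases eq_or_ne j i with rfl | h
        · simp
        · simp [h]
      simpa [Pi.single_apply, ite_smul] using this
    calc ∑ i, ‖x i‖ ^ s ≤ ∑ i : Fin n, (1 : ℝ) :=
          sum_le_sum fun i _ => Real.rpow_le_one (norm_nonneg _) (h1 i) hs.le
      _ = n := by simp
  have hx₀A : ∑ i, ‖x₀ i‖ ^ s ≤ sSup A := le_csSup hA ⟨x₀, hx₀, rfl⟩
  have hKpos : 0 < sSup A := lt_of_lt_of_le h0 hx₀A
  obtain ⟨_, ⟨x, hx, rfl⟩, hlt⟩ := exists_lt_of_lt_csSup (s := A) (b := sSup A * (2 * n / (2 * n + 1)))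
    ⟨_, x₀, hx₀, rfl⟩ (mul_lt_of_lt_one_right hKpos
      (by rw [div_lt_one (by positivity)]; linarith))
  set V := ∑ i, ‖x i‖ ^ s with hV
  have hKV : sSup A ≤ V + V / (2 * n) := by
    rw [← mul_div_assoc, div_lt_iff₀ (by positivity)] at hlt
    have : V + V / (2 * n) = V * (2 * n + 1) / (2 * n) := by field_simp
    rw [this, le_div_iff₀ (by positivity)]
    exact hlt.le
  refine ⟨x, hx, ?_, fun S a ha hS => ?_⟩
  · have h23 : (2 / 3 : ℝ) ≤ 2 * n / (2 * n + 1) := by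
      rw [div_le_div_iff₀ (by norm_num) (by positivity)]; linarith
    nlinarith
  · obtain ⟨i₀, hi₀⟩ := hS
    let x' : Fin n → Y := fun i =>
      if i = i₀ then ∑ j ∈ S, a j • x j else if i ∈ S then 0 else x i
    have hx'S : ∀ i ∈ S, i ≠ i₀ → x' i = 0 := fun i hi h => by simp [x', h, hi]
    have hx'c : ∀ i ∈ Sᶜ, x' i = x i := fun i hi => by
      have h1 : i ∉ S := by simpa using hi
      have h2 : i ≠ i₀ := fun h => h1 (h ▸ hi₀)
      simp [x', h1, h2]
    have hx'0 : x' i₀ = ∑ j ∈ S, a j • x j := by simp [x']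
    have hx' : ∀ b : Fin n → ℝ, (∀ i, |b i| ≤ 1) → ‖∑ i, b i • x' i‖ ≤ 1 := by
      intro b hb
      have h1 : ∑ i, b i • x' i = ∑ i, (if i ∈ S then b i₀ * a i else b i) • x i := by
        rw [← sum_add_sum_compl S, ← sum_add_sum_compl S (fun i => (if i ∈ S then _ else _) • x i)]
        congr 1
        · rw [sum_eq_single_of_mem i₀ hi₀ fun i hi h => by rw [hx'S i hi h, smul_zero], hx'0,
            smul_sum]
          refine sum_congr rfl fun i hi => ?_
          rw [if_pos hi, smul_smul]
        · refine sum_congr rfl fun i hi => ?_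
          rw [hx'c i hi, if_neg (by simpa using hi)]
      rw [h1]
      refine hx _ fun i => ?_
      split_ifs with h
      · rw [abs_mul]
        exact mul_le_one₀ (hb _) (abs_nonneg _) (ha i h)
      · exact hb i
    have h1 := le_csSup hA ⟨x', hx', rfl⟩
    rw [← sum_add_sum_compl S, sum_eq_single_of_mem (f := fun i => ‖x' i‖ ^ s) i₀ hi₀
      fun i hi h => by rw [hx'S i hi h, norm_zero, Real.zero_rpow hs.ne'],
      hx'0, sum_congr (s₁ := Sᶜ) rfl fun i hi => by rw [hx'c i hi]] at h1
    have h2 : ∑ i ∈ S, ‖x i‖ ^ s + ∑ i ∈ Sᶜ, ‖x i‖ ^ s = V := sum_add_sum_compl S _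
    linarith

end Extrapolation

section Orlicz

open Finset

variable {Y : Type*} [NormedAddCommGroup Y] [NormedSpace ℝ Y]

lemma norm_sum_smul_le_of_forall_le_one {n : ℕ} {y : Fin n → Y} {lam : ℝ} (hl : 0 < lam)
    (h : ∀ b : Fin n → ℝ, ∑ i, |b i| ^ lam ≤ 1 → ‖∑ i, b i • y i‖ ≤ 1) (b : Fin n → ℝ) :
    ‖∑ i, b i • y i‖ ≤ (∑ i, |b i| ^ lam) ^ (1 / lam) := by
  have hB0 : 0 ≤ ∑ i, |b i| ^ lam := sum_nonneg fun i _ => by positivity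
  rcases hB0.eq_or_lt with h0 | h0
  · have hb : ∀ i, b i = 0 := by
      intro i
      have h1 := (sum_eq_zero_iff_of_nonneg fun i _ => by positivity).mp h0.symm i (mem_univ i)
      rw [Real.rpow_eq_zero (abs_nonneg _) hl.ne'] at h1
      exact abs_eq_zero.mp h1
    simp only [hb, zero_smul, sum_const_zero, norm_zero]
    positivity
  · set β := (∑ i, |b i| ^ lam) ^ (1 / lam) with hβ
    have hβ0 : 0 < β := by positivity
    have hβl : β ^ lam = ∑ i, |b i| ^ lam := by
      rw [hβ, one_div, Real.rpow_inv_rpow hB0 hl.ne']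
    have h1 := h (fun i => b i / β) (by
      simp only [abs_div, abs_of_pos hβ0, Real.div_rpow (abs_nonneg _) hβ0.le, ← sum_div, hβl]
      rw [div_self h0.ne'])
    have h2 : ∑ i, b i • y i = β • ∑ i, (b i / β) • y i := by
      rw [smul_sum]
      exact sum_congr rfl fun i _ => by rw [smul_smul, mul_div_cancel₀ _ hβ0.ne']
    rw [h2, norm_smul, Real.norm_of_nonneg hβ0.le]
    exact mul_le_of_le_one_right hβ0.le h1

lemma rpow_le_of_nearly_extremal {q lam t s C : ℝ} (ht0 : 0 < t) (ht : 1 / t = 1 / q - 1 / lam)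
    (hq : 0 < q) (hqs : q < s) (hs : 1 ≤ s) (hsl : s < lam)
    (hA : ∀ (n : ℕ) (y : Fin n → Y),
      (∀ b : Fin n → ℝ, ‖∑ i, b i • y i‖ ≤ (∑ i, |b i| ^ lam) ^ (1 / lam)) →
      ∑ i, ‖y i‖ ^ t ≤ C)
    {n : ℕ} (hn : 0 < n) (x : Fin n → Y)
    (hx : ∀ a : Fin n → ℝ, (∀ i, |a i| ≤ 1) → ‖∑ i, a i • x i‖ ≤ 1)
    (hV : 0 < ∑ i, ‖x i‖ ^ s)
    (hS : ∀ (S : Finset (Fin n)) (a : Fin n → ℝ), (∀ i ∈ S, |a i| ≤ 1) → S.Nonempty →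
        ‖∑ i ∈ S, a i • x i‖ ^ s ≤ ∑ i ∈ S, ‖x i‖ ^ s + (∑ i, ‖x i‖ ^ s) / (2 * n)) :
    ((∑ i, ‖x i‖ ^ s) ^ (1 / s - 1 / lam) / (1 + 4 / (1 - 2 ^ (1 - lam / s)))) ^ t ≤ 2 * C := by
  classical
  have hs0 : 0 < s := by linarith
  have hl0 : 0 < lam := by linarith
  have hnr : (0 : ℝ) < n := by exact_mod_cast hn
  set V := ∑ i, ‖x i‖ ^ s with hVdef
  set C₁ : ℝ := 1 + 4 / (1 - 2 ^ (1 - lam / s)) with hC₁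
  have hC₁0 : 0 < C₁ := by
    have : (2 : ℝ) ^ (1 - lam / s) < 1 := Real.rpow_lt_one_of_one_lt_of_neg (by norm_num)
      (by rw [sub_neg, one_lt_div hs0]; exact hsl)
    have : 0 < 1 - (2 : ℝ) ^ (1 - lam / s) := by linarith
    positivity
  set p : Fin n → ℝ := fun i => ‖x i‖ ^ s / V with hp
  have hp0 : ∀ i, 0 ≤ p i := fun i => by positivity
  have hp1 : ∀ i, p i ≤ 1 := fun i => by
    rw [div_le_one hV]
    exact single_le_sum (f := fun i => ‖x i‖ ^ s) (fun i _ => by positivity) (mem_univ i)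
  set G := univ.filter fun i => V / (2 * n) ≤ ‖x i‖ ^ s with hG
  have hGp : ∀ i ∈ G, 0 < p i := fun i hi =>
    div_pos (lt_of_lt_of_le (by positivity) (mem_filter.mp hi).2) hV
  have hVp : ∀ S : Finset (Fin n), V * ∑ i ∈ S, p i = ∑ i ∈ S, ‖x i‖ ^ s := fun S => by
    rw [mul_sum]
    exact sum_congr rfl fun i _ => by simp only [hp]; field_simp
  have hGsum : 1 / 2 ≤ ∑ i ∈ G, p i := by
    have h1 := sum_filter_add_sum_filter_not univ (fun i => V / (2 * n) ≤ ‖x i‖ ^ s)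
      (fun i => ‖x i‖ ^ s)
    have h2 : ∑ i with ¬V / (2 * n) ≤ ‖x i‖ ^ s, ‖x i‖ ^ s ≤ n * (V / (2 * n)) := by
      refine (sum_le_card_nsmul _ _ (V / (2 * n)) fun i hi =>
        (not_le.mp (mem_filter.mp hi).2).le).trans ?_
      rw [nsmul_eq_mul]
      gcongr
      simpa using card_le_univ (univ.filter fun i => ¬V / (2 * n) ≤ ‖x i‖ ^ s)
    have h3 : (n : ℝ) * (V / (2 * n)) = V / 2 := by field_simp
    rw [h3] at h2
    have h4 := hVp G
    nlinarith
  set H := V ^ (1 / lam) with hH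
  have hH0 : 0 < H := by positivity
  have level := norm_sum_smul_le_of_levels (G := G) (x := x) (p := p) hs hsl hV
    (fun i _ => hp0 i)
    (fun S _ a ha => by
      have := hx (fun i => if i ∈ S then a i else 0) fun i => by
        split_ifs with h
        · exact ha i h
        · simp
      simpa [ite_smul, sum_ite_mem] using this)
    (fun S hSG a ha => by
      rcases S.eq_empty_or_nonempty with rfl | hne
      · simp [Real.zero_rpow hs0.ne']
      · refine (hS S a ha hne).trans ?_
        rw [mul_assoc, hVp]
        obtain ⟨i, hi⟩ := hne
        have h1 := (mem_filter.mp (hSG hi)).2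
        have h2 := single_le_sum (f := fun i => ‖x i‖ ^ s) (fun i _ => by positivity) hi
        linarith)
  set τ := 1 / t - 1 / s with hτ
  let y : Fin n → Y := fun i => if i ∈ G then (p i ^ τ / (C₁ * H)) • x i else 0
  have hy := hA n y (norm_sum_smul_le_of_forall_le_one hl0 fun b hb => by
    have h1 : ∑ i, b i • y i = (C₁ * H)⁻¹ • ∑ i ∈ G, (b i * p i ^ τ) • x i := by
      rw [smul_sum]
      simp only [y, smul_ite, smul_zero, sum_ite_mem, univ_inter, smul_smul]
      exact sum_congr rfl fun i _ => by congr 1; ring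
    rw [h1, norm_smul, norm_inv, Real.norm_of_nonneg (by positivity),
      inv_mul_le_iff₀ (by positivity), mul_one, mul_comm]
    refine level _ (le_trans (sum_le_sum fun i hi => ?_)
      ((sum_le_univ_sum_of_nonneg fun i => by positivity).trans hb))
    have hpi := hGp i hi
    rw [abs_mul, abs_of_nonneg (by positivity : 0 ≤ p i ^ τ),
      Real.mul_rpow (abs_nonneg _) (by positivity), mul_assoc, ← Real.rpow_mul hpi.le,
      ← Real.rpow_add_one hpi.ne']
    refine mul_le_of_le_one_right (by positivity) (Real.rpow_le_one hpi.le (hp1 i) ?_)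
    have : τ * lam + 1 = lam * (1 / q - 1 / s) := by
      rw [hτ, ht]; field_simp; ring
    rw [this]
    have := one_div_le_one_div_of_le hq hqs.le
    exact mul_nonneg hl0.le (by linarith))
  have hyt : ∀ i ∈ G, ‖y i‖ ^ t = p i * (V ^ (1 / s - 1 / lam) / C₁) ^ t := by
    intro i hi
    have hpi := hGp i hi
    have h1 : ‖x i‖ = V ^ (1 / s) * p i ^ (1 / s) := by
      rw [← Real.mul_rpow hV.le hpi.le, one_div,
        Real.eq_rpow_inv (norm_nonneg _) (by positivity) hs0.ne']
      simp only [hp]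
      field_simp
    have h2 : ‖y i‖ = p i ^ (1 / t) * (V ^ (1 / s - 1 / lam) / C₁) := by
      simp only [y, if_pos hi]
      rw [norm_smul, Real.norm_of_nonneg (by positivity), h1, hτ, Real.rpow_sub hpi,
        Real.rpow_sub hV, ← hH]
      field_simp
    rw [h2, Real.mul_rpow (by positivity) (by positivity), one_div,
      Real.rpow_inv_rpow hpi.le ht0.ne']
  have h3 : (∑ i ∈ G, p i) * (V ^ (1 / s - 1 / lam) / C₁) ^ t ≤ C := by
    rw [sum_mul, ← sum_congr rfl hyt]
    exact (sum_le_univ_sum_of_nonneg fun i => by positivity).trans hy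
  have h4 : 0 ≤ (V ^ (1 / s - 1 / lam) / C₁) ^ t := by positivity
  nlinarith

lemma hasOrlicz_of_bound {q lam t s : ℝ} (ht0 : 0 < t) (ht : 1 / t = 1 / q - 1 / lam)
    (hq : 0 < q) (hqs : q < s) (hs : 1 ≤ s) (hsl : s < lam)
    (hA : ∃ C, ∀ (n : ℕ) (y : Fin n → Y),
      (∀ b : Fin n → ℝ, ‖∑ i, b i • y i‖ ≤ (∑ i, |b i| ^ lam) ^ (1 / lam)) →
      ∑ i, ‖y i‖ ^ t ≤ C) :
    HasOrlicz Y s := by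
  obtain ⟨C, hA⟩ := hA
  have hs0 : 0 < s := by linarith
  have hC : 0 ≤ C := by
    have := hA 0 Fin.elim0 fun b => by simp [Real.zero_rpow_nonneg]
    simpa using this
  set C₁ : ℝ := 1 + 4 / (1 - 2 ^ (1 - lam / s)) with hC₁
  have hC₁0 : 0 < C₁ := by
    have : (2 : ℝ) ^ (1 - lam / s) < 1 := Real.rpow_lt_one_of_one_lt_of_neg (by norm_num)
      (by rw [sub_neg, one_lt_div hs0]; exact hsl)
    have : 0 < 1 - (2 : ℝ) ^ (1 - lam / s) := by linarith
    positivity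
  have hδ : 0 < 1 / s - 1 / lam := by
    rw [sub_pos]; exact one_div_lt_one_div_of_lt hs0 hsl
  set D := (C₁ * (2 * C) ^ t⁻¹) ^ (1 / s - 1 / lam)⁻¹ with hD
  have hD0 : 0 ≤ D := by positivity
  have key : ∀ (n : ℕ) (x : Fin n → Y),
      (∀ a : Fin n → ℝ, (∀ i, |a i| ≤ 1) → ‖∑ i, a i • x i‖ ≤ 1) →
      ∑ i, ‖x i‖ ^ s ≤ 3 / 2 * D := by
    intro n x₀ hx₀
    rcases (sum_nonneg fun i _ => by positivity : 0 ≤ ∑ i, ‖x₀ i‖ ^ s).eq_or_lt with h0 | h0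
    · rw [← h0]; positivity
    have hn : 0 < n := by
      rcases Nat.eq_zero_or_pos n with rfl | h
      · simp at h0
      · exact h
    obtain ⟨x, hx, hx₁, hS⟩ := exists_nearly_extremal hs0 hn x₀ hx₀ h0
    have hV : 0 < ∑ i, ‖x i‖ ^ s := by linarith
    have h1 := rpow_le_of_nearly_extremal ht0 ht hq hqs hs hsl hA hn x hx hV hS
    rw [← Real.le_rpow_inv_iff_of_pos (by positivity) (by positivity) ht0,
      div_le_iff₀ hC₁0, mul_comm,
      ← Real.le_rpow_inv_iff_of_pos (by positivity) (by positivity) hδ] at h1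
    have h2 : ∑ i, ‖x i‖ ^ s ≤ D := h1
    linarith
  refine ⟨3 / 2 * D, fun n x M hM => ?_⟩
  have hM0 : 0 ≤ M := (norm_nonneg _).trans (hM 0 (by simp))
  rcases hM0.eq_or_lt with rfl | hMpos
  · have hx0 : ∀ i, ‖x i‖ ≤ 0 := by
      intro i
      have := hM (Pi.single i 1) fun j => by
        rcases eq_or_ne j i with rfl | h
        · simp
        · simp [h]
      simpa [Pi.single_apply, ite_smul] using this
    have : ∀ i, ‖x i‖ = 0 := fun i => le_antisymm (hx0 i) (norm_nonneg _)
    simp [this, Real.zero_rpow hs0.ne']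
  · have h1 := key n (fun i => M⁻¹ • x i) fun a ha => by
      simp only [smul_comm _ M⁻¹, ← smul_sum]
      rw [norm_smul, norm_inv, Real.norm_of_nonneg hM0, inv_mul_le_iff₀ hMpos, mul_one]
      exact hM a ha
    simp only [norm_smul, norm_inv, Real.norm_of_nonneg hM0, Real.mul_rpow (inv_nonneg.mpr hM0)
      (norm_nonneg _), ← mul_sum, Real.inv_rpow hM0] at h1
    rwa [inv_mul_le_iff₀ (by positivity), mul_comm] at h1

/-- An infinite dimensional space with the `(s, 1)`-summing property has `s ≥ 2`. -/
lemma two_le_of_hasOrlicz (hY : ¬FiniteDimensional ℝ Y) {s : ℝ} (hs : 0 < s)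
    (hD : HasOrlicz Y s) : 2 ≤ s := by
  by_contra! hs2
  obtain ⟨K, hK⟩ := hD
  have h1 : ∀ n : ℕ, (n : ℝ) * (1 / 4) ^ s ≤ K * (n : ℝ) ^ (s / 2) := by
    intro n
    obtain ⟨x, hx, hb⟩ := exists_norm_sum_smul_le_sqrt hY n
    have h2 := hK n x (√n) fun a ha => (hb a).trans (Real.sqrt_le_sqrt (by
      calc ∑ i, a i ^ 2 ≤ ∑ i : Fin n, (1 : ℝ) := sum_le_sum fun i _ => by
            rw [← sq_abs]; exact pow_le_one₀ (abs_nonneg _) (ha i)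
        _ = n := by simp))
    have h3 : (n : ℝ) * (1 / 4) ^ s ≤ ∑ i, ‖x i‖ ^ s := by
      calc (n : ℝ) * (1 / 4) ^ s = ∑ i : Fin n, (1 / 4 : ℝ) ^ s := by simp
        _ ≤ _ := sum_le_sum fun i _ => Real.rpow_le_rpow (by norm_num) (hx i) hs.le
    rw [Real.sqrt_eq_rpow, ← Real.rpow_mul (by positivity), show 1 / 2 * s = s / 2 by ring] at h2
    exact h3.trans h2
  obtain ⟨n, hn, hn1⟩ := ((((tendsto_rpow_atTop (y := 1 - s / 2) (by linarith)).comp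
    tendsto_natCast_atTop_atTop).eventually_gt_atTop (K / (1 / 4) ^ s)).and
      (Filter.eventually_ge_atTop 1)).exists
  have hnr : (0 : ℝ) < n := by exact_mod_cast hn1
  simp only [Function.comp_apply] at hn
  rw [div_lt_iff₀ (by positivity), Real.rpow_sub hnr, Real.rpow_one, div_mul_eq_mul_div,
    lt_div_iff₀ (by positivity)] at hn
  exact absurd (h1 n) (not_le.mpr hn)

/-- The geometric consequences of the extrapolated bound. -/
lemma two_le_and_hasCotype (hY : ¬FiniteDimensional ℝ Y) {q lam t : ℝ} (hq : 0 < q)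
    (hlam : 1 < lam) (hql : q < lam) (ht0 : 0 < t) (ht : 1 / t = 1 / q - 1 / lam)
    (hA : ∃ C, ∀ (n : ℕ) (y : Fin n → Y),
      (∀ b : Fin n → ℝ, ‖∑ i, b i • y i‖ ≤ (∑ i, |b i| ^ lam) ^ (1 / lam)) →
      ∑ i, ‖y i‖ ^ t ≤ C) :
    2 ≤ q ∧ ∀ s : ℝ, q < s → HasCotype Y s := by
  have hD : ∀ s, q < s → 1 < s → s < lam → HasOrlicz Y s := fun s h1 h2 h3 =>
    hasOrlicz_of_bound ht0 ht hq h1 h2.le h3 hA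
  have h2q : 2 ≤ q := by
    by_contra! h
    obtain ⟨s, hs1, hs2⟩ := exists_between (max_lt (lt_min hql h) (lt_min hlam one_lt_two))
    rw [max_lt_iff] at hs1
    rw [lt_min_iff] at hs2
    have := two_le_of_hasOrlicz hY (by linarith) (hD s hs1.1 hs1.2 hs2.1)
    linarith
  refine ⟨h2q, fun s hs => ?_⟩
  obtain ⟨p, hp1, hp2⟩ := exists_between (lt_min hs hql)
  rw [lt_min_iff] at hp2
  exact hasCotype_of_hasOrlicz (by linarith) hp2.1 (hD p hp1 (by linarith) hp2.2)

end Orlicz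

section Summing

open Finset

/-- Hölder's inequality for finitely many factors. -/
lemma sum_prod_rpow_le {I J : Type*} [Fintype I] [Fintype J] {w : I → ℝ} (hw0 : ∀ i, 0 < w i)
    (hw : ∑ i, w i = 1) {u : I → J → ℝ} (hu : ∀ i j, 0 ≤ u i j) {U : I → ℝ}
    (hU : ∀ i, ∑ j, u i j ≤ U i) :
    ∑ j, ∏ i, u i j ^ w i ≤ ∏ i, U i ^ w i := by
  have hU0 : ∀ i, 0 ≤ U i := fun i => (sum_nonneg fun j _ => hu i j).trans (hU i)
  by_cases h : ∃ i, U i = 0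
  · obtain ⟨i, hi⟩ := h
    have h0 : ∀ j, u i j = 0 := fun j => le_antisymm
      ((single_le_sum (fun j _ => hu i j) (mem_univ j)).trans ((hU i).trans hi.le)) (hu i j)
    rw [sum_eq_zero fun j _ => prod_eq_zero (mem_univ i) (by
      rw [h0 j, Real.zero_rpow (hw0 i).ne'])]
    exact prod_nonneg fun i _ => Real.rpow_nonneg (hU0 i) _
  · push Not at h
    have hpos : ∀ i, 0 < U i := fun i => (hU0 i).lt_of_ne' (h i)
    have hP : 0 < ∏ i, U i ^ w i := prod_pos fun i _ => Real.rpow_pos_of_pos (hpos i) _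
    have h1 : ∀ j, ∏ i, u i j ^ w i ≤ (∏ i, U i ^ w i) * ∑ i, w i * (u i j / U i) := by
      intro j
      have := Real.geom_mean_le_arith_mean_weighted univ w (fun i => u i j / U i)
        (fun i _ => (hw0 i).le) hw fun i _ => div_nonneg (hu i j) (hU0 i)
      simp only [Real.div_rpow (hu _ j) (hU0 _), prod_div_distrib] at this
      rwa [div_le_iff₀ hP, mul_comm] at this
    calc ∑ j, ∏ i, u i j ^ w i ≤ ∑ j, (∏ i, U i ^ w i) * ∑ i, w i * (u i j / U i) :=
          sum_le_sum fun j _ => h1 j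
      _ = (∏ i, U i ^ w i) * ∑ i, w i * ((∑ j, u i j) / U i) := by
          rw [← mul_sum, sum_comm]
          simp only [sum_div, mul_sum]
      _ ≤ (∏ i, U i ^ w i) * ∑ i, w i * 1 := by
          refine mul_le_mul_of_nonneg_left (sum_le_sum fun i _ =>
            mul_le_mul_of_nonneg_left ?_ (hw0 i).le) hP.le
          exact (div_le_one (hpos i)).mpr (hU i)
      _ = _ := by simp [hw]

variable {𝕂 : Type*} [RCLike 𝕂]

/-- The diagonal multilinear map on coordinates `σ j` with values `y j`. -/
lemma exists_diagonal_multilinear {I : Type*} [Fintype I] {r : I → ℝ}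
    (hr : ∀ i, 1 ≤ r i) [∀ i, Fact (1 ≤ ENNReal.ofReal (r i))]
    {Y : Type*} [NormedAddCommGroup Y] [NormedSpace 𝕂 Y] {lam : ℝ} (hlam : 0 < lam)
    (hsum : ∑ i, lam / r i = 1) {n : ℕ} {y : Fin n → Y}
    (hy : ∀ b : Fin n → 𝕂, ‖∑ i, b i • y i‖ ≤ (∑ i, ‖b i‖ ^ lam) ^ (1 / lam))
    {σ : Fin n → ℕ} (hσ : Function.Injective σ) :
    ∃ T : ContinuousMultilinearMap 𝕂
        (fun i : I => lp (fun _ : ℕ => 𝕂) (ENNReal.ofReal (r i))) Y,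
      ‖T‖ ≤ 1 ∧ ∀ x, T x = ∑ j, (∏ i, x i (σ j)) • y j := by
  classical
  have hr0 : ∀ i, 0 < r i := fun i => by linarith [hr i]
  let T : ContinuousMultilinearMap 𝕂
      (fun i : I => lp (fun _ : ℕ => 𝕂) (ENNReal.ofReal (r i))) Y :=
    ∑ j, ((ContinuousMultilinearMap.mkPiAlgebra 𝕂 I 𝕂).compContinuousLinearMap
      fun i => lp.evalCLM 𝕂 (fun _ : ℕ => 𝕂) (ENNReal.ofReal (r i)) (σ j)).smulRight (y j)
  have hT : ∀ x, T x = ∑ j, (∏ i, x i (σ j)) • y j := fun x => by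
    simp [T, lp.evalCLM]
  refine ⟨T, T.opNorm_le_bound zero_le_one fun x => ?_, hT⟩
  rw [hT, one_mul]
  refine (hy _).trans ?_
  rw [one_div, Real.rpow_inv_le_iff_of_pos
    (sum_nonneg fun _ _ => Real.rpow_nonneg (norm_nonneg _) _)
    (prod_nonneg fun _ _ => norm_nonneg _) hlam,
    ← Real.finsetProd_rpow _ _ fun _ _ => norm_nonneg _]
  have hpow : ∀ (i : I) {a : ℝ}, 0 ≤ a → a ^ lam = (a ^ r i) ^ (lam / r i) := fun i a ha => by
    rw [← Real.rpow_mul ha, mul_div_cancel₀ _ (hr0 i).ne']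
  calc ∑ j, ‖∏ i, x i (σ j)‖ ^ lam = ∑ j, ∏ i, (‖x i (σ j)‖ ^ r i) ^ (lam / r i) := by
        refine sum_congr rfl fun j _ => ?_
        rw [norm_prod, ← Real.finsetProd_rpow _ _ fun _ _ => norm_nonneg _]
        exact prod_congr rfl fun i _ => hpow i (norm_nonneg _)
    _ ≤ ∏ i, (‖x i‖ ^ r i) ^ (lam / r i) := by
        refine sum_prod_rpow_le (fun i => div_pos hlam (hr0 i)) hsum
          (fun i j => Real.rpow_nonneg (norm_nonneg _) _) fun i => ?_
        have hp : (ENNReal.ofReal (r i)).toReal = r i := ENNReal.toReal_ofReal (hr0 i).le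
        have := lp.sum_rpow_le_norm_rpow (by rw [hp]; exact hr0 i) (x i) (univ.map ⟨σ, hσ⟩)
        simpa [hp] using this
    _ = _ := prod_congr rfl fun i _ => (hpow i (norm_nonneg _)).symm

/-- Weighted unit vectors of `ℓ_r` with `r`-summable weights are weakly `1`-summable. -/
lemma weaklySummable_extend_single {r : ℝ} (hr : 1 ≤ r) [Fact (1 ≤ ENNReal.ofReal r)]
    {ι : Type*} {e : ι → ℕ} (he : Function.Injective e) {d : ι → ℝ}
    (hd : ∀ a, 0 ≤ d a) (hs : Summable fun a => d a ^ r) :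
    WeaklySummable 𝕂 (Function.extend e
      (fun a => (lp.single (ENNReal.ofReal r) (e a) (d a : 𝕂) :
        lp (fun _ : ℕ => 𝕂) (ENNReal.ofReal r))) 0) := by
  classical
  intro φ
  have hr0 : 0 < r := by linarith
  have hp : (ENNReal.ofReal r).toReal = r := ENNReal.toReal_ofReal hr0.le
  rw [← he.summable_iff (fun j hj => by
    rw [Function.extend_apply' _ _ _ hj]; simp)]
  refine summable_of_sum_le (c := ‖φ‖ * (∑' a, d a ^ r) ^ (1 / r)) (fun _ => norm_nonneg _)
    fun F => ?_
  simp only [Function.comp_apply, he.extend_apply]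
  let v : ι → lp (fun _ : ℕ => 𝕂) (ENNReal.ofReal r) :=
    fun a => lp.single (ENNReal.ofReal r) (e a) (d a : 𝕂)
  have hθ : ∀ z : 𝕂, ∃ θ : 𝕂, ‖θ‖ ≤ 1 ∧ θ * z = (‖z‖ : 𝕂) := fun z => by
    by_cases hz : z = 0
    · exact ⟨0, by simp, by simp [hz]⟩
    · refine ⟨(‖z‖ : 𝕂) / z, ?_, div_mul_cancel₀ _ hz⟩
      simp [hz]
  choose θ hθ1 hθ2 using fun a => hθ (φ (v a))
  have h1 : ∑ a ∈ F, ‖φ (v a)‖ = ‖φ (∑ a ∈ F, θ a • v a)‖ := by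
    rw [map_sum]
    simp only [map_smul, smul_eq_mul, hθ2]
    rw [← RCLike.ofReal_sum, RCLike.norm_ofReal, abs_of_nonneg (sum_nonneg fun _ _ => norm_nonneg _)]
  have h2 : ‖∑ a ∈ F, θ a • v a‖ ^ r = ∑ a ∈ F, ‖θ a * (d a : 𝕂)‖ ^ r := by
    let g : ℕ → 𝕂 := Function.extend e (fun a => θ a * (d a : 𝕂)) 0
    have := lp.norm_sum_single (p := ENNReal.ofReal r) (E := fun _ : ℕ => 𝕂)
      (by rw [hp]; exact hr0) g (F.map ⟨e, he⟩)
    rw [hp] at this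
    simpa [g, he.extend_apply, v, ← lp.single_smul] using this
  have h3 : ‖∑ a ∈ F, θ a • v a‖ ≤ (∑' a, d a ^ r) ^ (1 / r) := by
    rw [one_div, Real.le_rpow_inv_iff_of_pos (norm_nonneg _)
      (tsum_nonneg fun a => Real.rpow_nonneg (hd a) _) hr0, h2]
    refine le_trans (sum_le_sum fun a _ => ?_)
      (hs.sum_le_tsum F fun a _ => Real.rpow_nonneg (hd a) _)
    refine Real.rpow_le_rpow (norm_nonneg _) ?_ hr0.le
    rw [norm_mul, RCLike.norm_ofReal, abs_of_nonneg (hd a)]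
    exact mul_le_of_le_one_left (hd a) (hθ1 a)
  exact h1.le.trans ((φ.le_opNorm _).trans (mul_le_mul_of_nonneg_left h3 (norm_nonneg _)))

end Summing

section Extrapolation

open Finset

/-- For large `Z`, the `q`-sum of a block normalised to weight `β` exceeds `1`. -/
lemma exists_one_le_of_lt {q lam β : ℝ} (hlam : 0 < lam) (hql : q < lam) (hβ : 0 < β) :
    ∃ B : ℝ, 0 ≤ B ∧ ∀ Z, B < Z → 1 ≤ β ^ q * ((β / Z) ^ (q / lam) * Z) := by
  have h1 : 0 < 1 - q / lam := by rw [sub_pos, div_lt_one hlam]; exact hql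
  have hK : 0 < β ^ q * β ^ (q / lam) := by positivity
  obtain ⟨B, hB⟩ := Filter.eventually_atTop.mp
    ((tendsto_rpow_atTop h1).eventually_ge_atTop (1 / (β ^ q * β ^ (q / lam))))
  refine ⟨max B 0, le_max_right _ _, fun Z hZ => ?_⟩
  rw [max_lt_iff] at hZ
  have h2 := hB Z hZ.1.le
  rw [div_le_iff₀ hK, Real.rpow_sub hZ.2, Real.rpow_one] at h2
  rw [Real.div_rpow hβ.le hZ.2.le]
  refine h2.trans (le_of_eq ?_)
  field_simp

variable {𝕂 : Type*} [RCLike 𝕂]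

/-- If all polynomials are `(q; 1)`-summing, then the bound `1 / t = 1 / q - 1 / lam` holds
uniformly for the images of the unit vectors under contractions `ℓ_lam ^ N → Y`. -/
lemma exists_bound_of_summing {m : ℕ} {n : Fin m → ℕ} {r : Fin m → ℝ} (hr : ∀ k, 1 ≤ r k)
    [hfact : ∀ k, Fact (1 ≤ ENNReal.ofReal (r k))]
    {Y : Type*} [NormedAddCommGroup Y] [NormedSpace 𝕂 Y] [CompleteSpace Y]
    {q lam t : ℝ} (hq : 0 < q) (hlam : 0 < lam) (hql : q < lam) (ht0 : 0 < t)
    (ht : 1 / t = 1 / q - 1 / lam)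
    (hw : ∑ i : Σ k : Fin m, Fin (n k), lam / r i.1 = 1)
    (hsum : ∀ P : (∀ k, lp (fun _ : ℕ => 𝕂) (ENNReal.ofReal (r k))) → Y, IsMultiPoly 𝕂 n P →
      ∀ x : ∀ k, ℕ → lp (fun _ : ℕ => 𝕂) (ENNReal.ofReal (r k)),
        (∀ k, WeaklySummable 𝕂 (x k)) → Summable fun j => ‖P fun k => x k j‖ ^ q) :
    ∃ C : ℝ, ∀ (N : ℕ) (y : Fin N → Y),
      (∀ b : Fin N → 𝕂, ‖∑ i, b i • y i‖ ≤ (∑ i, ‖b i‖ ^ lam) ^ (1 / lam)) →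
      ∑ i, ‖y i‖ ^ t ≤ C := by
  classical
  by_contra! hC
  have hr0 : ∀ k, 0 < r k := fun k => by linarith [hr k]
  let β : ℕ → ℝ := fun l => (1 / 2) ^ l
  have hβ : ∀ l, 0 < β l := fun l => by positivity
  have hβs : Summable β := summable_geometric_two
  choose B hB0 hB using fun l => exists_one_le_of_lt hlam hql (hβ l)
  choose N y hy hZ using fun l => hC (B l)
  let Z : ℕ → ℝ := fun l => ∑ i, ‖y l i‖ ^ t
  have hZ0 : ∀ l, 0 < Z l := fun l => (hB0 l).trans_lt (hZ l)
  let e : (Σ l, Fin (N l)) → ℕ := Encodable.encode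
  have he : Function.Injective e := Encodable.encode_injective
  let I := Σ k : Fin m, Fin (n k)
  have hI : Nonempty I := by
    by_contra h
    rw [not_nonempty_iff] at h
    simp at hw
  choose T hT1 hT using fun l => exists_diagonal_multilinear (𝕂 := 𝕂) (I := I)
    (r := fun i => r i.1) (fun i => hr i.1) hlam hw (hy l) (σ := fun j => e ⟨l, j⟩)
    fun i j h => by simpa using he h
  have hTs : Summable fun l => (β l : 𝕂) • T l := by
    refine Summable.of_norm_bounded hβs fun l => ?_
    rw [norm_smul, RCLike.norm_ofReal, abs_of_pos (hβ l)]
    exact mul_le_of_le_one_right (hβ l).le (hT1 l)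
  let S := ∑' l, (β l : 𝕂) • T l
  have hS : ∀ x, S x = ∑' l, (β l : 𝕂) • T l x := fun x =>
    (ContinuousMultilinearMap.apply 𝕂 _ Y x).map_tsum hTs
  let c : (Σ l, Fin (N l)) → ℝ := fun a =>
    (β a.1 / Z a.1) ^ (1 / lam) * ‖y a.1 a.2‖ ^ (t / lam)
  have hc0 : ∀ a, 0 ≤ c a := fun a => mul_nonneg
    (Real.rpow_nonneg (div_nonneg (hβ _).le (hZ0 _).le) _) (Real.rpow_nonneg (norm_nonneg _) _)
  have hcp : ∀ a p, c a ^ p = (β a.1 / Z a.1) ^ (p / lam) * ‖y a.1 a.2‖ ^ (t * p / lam) := by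
    intro a p
    have h0 : 0 ≤ β a.1 / Z a.1 := div_nonneg (hβ _).le (hZ0 _).le
    rw [Real.mul_rpow (Real.rpow_nonneg h0 _) (Real.rpow_nonneg (norm_nonneg _) _),
      ← Real.rpow_mul h0, ← Real.rpow_mul (norm_nonneg _)]
    congr 2 <;> ring
  have hcs : Summable fun a => c a ^ lam := by
    rw [summable_sigma_of_nonneg fun a => Real.rpow_nonneg (hc0 a) _]
    refine ⟨fun l => (hasSum_fintype _).summable, hβs.congr fun l => ?_⟩
    rw [tsum_fintype]
    simp only [hcp, div_self hlam.ne', Real.rpow_one, mul_div_assoc, mul_one, ← mul_sum]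
    exact (div_mul_cancel₀ _ (hZ0 l).ne').symm
  let x : ∀ k, ℕ → lp (fun _ : ℕ => 𝕂) (ENNReal.ofReal (r k)) := fun k =>
    Function.extend e (fun a => lp.single (ENNReal.ofReal (r k)) (e a)
      ((c a ^ (lam / r k) : ℝ) : 𝕂)) 0
  have hx : ∀ k, WeaklySummable 𝕂 (x k) := fun k =>
    weaklySummable_extend_single (hr k) he (fun a => Real.rpow_nonneg (hc0 a) _) <|
      hcs.congr fun a => by
        rw [← Real.rpow_mul (hc0 a), div_mul_cancel₀ _ (hr0 k).ne']
  have hfin := hsum (fun z => S fun i => z i.1) ⟨S, fun _ => rfl⟩ x hx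
  have hval : ∀ a, ‖S fun i => x i.1 (e a)‖ = β a.1 * (c a * ‖y a.1 a.2‖) := by
    rintro ⟨l, j⟩
    have hT' : ∀ l' : ℕ, (T l' fun i => x i.1 (e ⟨l, j⟩)) =
        if l' = l then (c ⟨l, j⟩ : 𝕂) • y l j else 0 := by
      intro l'
      rw [hT]
      simp only [x, he.extend_apply]
      have hne : ∀ j' : Fin (N l'), (⟨l', j'⟩ : Σ l, Fin (N l)) ≠ ⟨l, j⟩ →
          (∏ i : I, (lp.single (ENNReal.ofReal (r i.1)) (e ⟨l, j⟩)
            ((c ⟨l, j⟩ ^ (lam / r i.1) : ℝ) : 𝕂) : lp (fun _ : ℕ => 𝕂) _) (e ⟨l', j'⟩)) •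
            y l' j' = 0 := by
        intro j' h
        rw [prod_eq_zero (mem_univ hI.some) (lp.single_apply_ne _ _ _ (he.ne h)), zero_smul]
      split_ifs with h
      · subst h
        rw [sum_eq_single j (fun j' _ h => hne j' (by simpa using h)) (by simp)]
        simp only [lp.single_apply_self]
        rw [← RCLike.ofReal_prod, ← Real.rpow_sum_of_nonneg (hc0 _)
          (fun i _ => (div_pos hlam (hr0 _)).le), hw, Real.rpow_one]
      · exact sum_eq_zero fun j' _ => hne j' fun h' => h (congrArg Sigma.fst h')
    rw [hS, tsum_eq_single l (fun l' h => by rw [hT', if_neg h, smul_zero]), hT', if_pos rfl,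
      norm_smul, norm_smul, RCLike.norm_ofReal, RCLike.norm_ofReal, abs_of_pos (hβ l),
      abs_of_nonneg (hc0 _)]
  have hsig := (hfin.comp_injective he).sigma.tendsto_atTop_zero
  obtain ⟨l, hl⟩ := (hsig.eventually_lt_const one_pos).exists
  refine absurd (hB l (Z l) (hZ l)) (not_le.mpr (lt_of_eq_of_lt ?_ hl))
  have htq : t * q / lam + q = t := by
    field_simp at ht ⊢
    linarith
  rw [tsum_fintype]
  simp only [Function.comp_apply, hval]
  change β l ^ q * ((β l / Z l) ^ (q / lam) * ∑ i, ‖y l i‖ ^ t) = _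
  rw [mul_sum, mul_sum]
  refine sum_congr rfl fun i _ => ?_
  rw [Real.mul_rpow (hβ l).le (mul_nonneg (hc0 _) (norm_nonneg _)),
    Real.mul_rpow (hc0 _) (norm_nonneg _), hcp, mul_assoc _ _ (‖y l i‖ ^ q),
    ← Real.rpow_add_of_nonneg (norm_nonneg _) (by positivity) hq.le, htq]

end Extrapolation

section Main

open Finset

variable {𝕂 : Type*} [RCLike 𝕂] {Y : Type*} [NormedAddCommGroup Y] [NormedSpace 𝕂 Y]

/-- In a nontrivial space, a uniform bound for contractions from `ℓ_lam ^ N` forces `lam > 1`. -/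
lemma one_lt_of_bound [Nontrivial Y] {lam t : ℝ} (hlam : 0 < lam)
    (hA : ∃ C : ℝ, ∀ (N : ℕ) (y : Fin N → Y),
      (∀ b : Fin N → 𝕂, ‖∑ i, b i • y i‖ ≤ (∑ i, ‖b i‖ ^ lam) ^ (1 / lam)) →
      ∑ i, ‖y i‖ ^ t ≤ C) : 1 < lam := by
  by_contra! h
  obtain ⟨C, hC⟩ := hA
  obtain ⟨v, hv⟩ := exists_ne (0 : Y)
  let u : Y := ((‖v‖⁻¹ : ℝ) : 𝕂) • v
  have hu : ‖u‖ = 1 := by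
    simp [u, norm_smul, hv]
  obtain ⟨N, hN⟩ := exists_nat_gt C
  have key : ∀ (s : Finset (Fin N)) (b : Fin N → 𝕂),
      (∑ i ∈ s, ‖b i‖) ^ lam ≤ ∑ i ∈ s, ‖b i‖ ^ lam := by
    intro s b
    induction s using Finset.induction_on with
    | empty => simp [Real.zero_rpow hlam.ne']
    | insert a s ha ih =>
      rw [sum_insert ha, sum_insert ha]
      exact (Real.rpow_add_le_add_rpow (norm_nonneg _) (sum_nonneg fun _ _ => norm_nonneg _)
        hlam.le h).trans (by gcongr)
  have := hC N (fun _ => u) fun b => by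
    rw [one_div, Real.le_rpow_inv_iff_of_pos (norm_nonneg _)
      (sum_nonneg fun _ _ => Real.rpow_nonneg (norm_nonneg _) _) hlam]
    refine (Real.rpow_le_rpow (norm_nonneg _) ?_ hlam.le).trans (key univ b)
    exact (norm_sum_le _ _).trans (sum_le_sum fun i _ => by rw [norm_smul, hu, mul_one])
  simp [hu] at this
  linarith

/-- Passing from `𝕂`-linear to real-linear contractions costs at most a factor `2`. -/
lemma bound_restrictScalars [NormedSpace ℝ Y] [IsScalarTower ℝ 𝕂 Y] {lam t : ℝ} (hlam : 0 < lam)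
    (hA : ∃ C : ℝ, ∀ (N : ℕ) (y : Fin N → Y),
      (∀ b : Fin N → 𝕂, ‖∑ i, b i • y i‖ ≤ (∑ i, ‖b i‖ ^ lam) ^ (1 / lam)) →
      ∑ i, ‖y i‖ ^ t ≤ C) :
    ∃ C : ℝ, ∀ (N : ℕ) (y : Fin N → Y),
      (∀ b : Fin N → ℝ, ‖∑ i, b i • y i‖ ≤ (∑ i, |b i| ^ lam) ^ (1 / lam)) →
      ∑ i, ‖y i‖ ^ t ≤ C := by
  obtain ⟨C, hC⟩ := hA
  refine ⟨2 ^ t * C, fun N y hy => ?_⟩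
  have hle : ∀ (b : Fin N → 𝕂) (g : Fin N → ℝ), (∀ i, |g i| ≤ ‖b i‖) →
      ‖∑ i, g i • y i‖ ≤ (∑ i, ‖b i‖ ^ lam) ^ (1 / lam) := fun b g hg =>
    (hy g).trans (Real.rpow_le_rpow (sum_nonneg fun _ _ => Real.rpow_nonneg (abs_nonneg _) _)
      (sum_le_sum fun i _ => Real.rpow_le_rpow (abs_nonneg _) (hg i) hlam.le) (by positivity))
  have h := hC N (fun i => (2⁻¹ : ℝ) • y i) fun b => by
    have hsplit : ∑ i, b i • (2⁻¹ : ℝ) • y i = (2⁻¹ : ℝ) • (∑ i, RCLike.re (b i) • y i +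
        (RCLike.I : 𝕂) • ∑ i, RCLike.im (b i) • y i) := by
      simp only [← algebraMap_smul 𝕂 (_ : ℝ) (_ : Y), smul_sum, ← sum_add_distrib, smul_add,
        smul_smul]
      refine sum_congr rfl fun i _ => ?_
      rw [← add_smul]
      congr 1
      simp only [RCLike.algebraMap_eq_ofReal]
      conv_lhs => rw [← RCLike.re_add_im (b i)]
      ring
    rw [hsplit, norm_smul]
    have h1 := hle b (fun i => RCLike.re (b i)) fun i => RCLike.abs_re_le_norm _
    have h2 := hle b (fun i => RCLike.im (b i)) fun i => RCLike.abs_im_le_norm _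
    have h3 : ‖(RCLike.I : 𝕂) • ∑ i, RCLike.im (b i) • y i‖ ≤
        (∑ i, ‖b i‖ ^ lam) ^ (1 / lam) := by
      rw [norm_smul]
      exact (mul_le_of_le_one_left (norm_nonneg _) (by
        rw [RCLike.norm_I]; split_ifs <;> norm_num)).trans h2
    have h4 := norm_add_le (∑ i, RCLike.re (b i) • y i)
      ((RCLike.I : 𝕂) • ∑ i, RCLike.im (b i) • y i)
    rw [norm_inv, Real.norm_ofNat]
    linarith
  simp only [norm_smul, Real.mul_rpow (norm_nonneg (2⁻¹ : ℝ)) (norm_nonneg _), ← mul_sum] at h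
  rwa [norm_inv, Real.norm_ofNat, Real.inv_rpow zero_le_two, inv_mul_le_iff₀ (by positivity)] at h

end Main

/-- If every continuous `(n₁,…,n_m)`-homogeneous polynomial from `ℓ_r₁ × ⋯ × ℓ_r_m` into an
infinite dimensional `Y` is absolutely `(q;1)`-summing, then
`q ≥ min (1/(n₁/r₁ + ⋯ + n_m/r_m)) (cot Y)`, i.e. either `q ≥ 1/(∑ n_k/r_k)` or `q ≥ 2` and
`Y` has cotype `s` for every `s > q`. -/
theorem stmt18 (𝕂 : Type*) [RCLike 𝕂] (m : ℕ) (hm : 0 < m) (n : Fin m → ℕ)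
    (hn : ∀ k, 1 ≤ n k) (r : Fin m → ℝ) (hr : ∀ k, 1 ≤ r k)
    [hfact : ∀ k, Fact (1 ≤ ENNReal.ofReal (r k))]
    (Y : Type*) [NormedAddCommGroup Y] [NormedSpace 𝕂 Y] [CompleteSpace Y]
    (hY : ¬FiniteDimensional 𝕂 Y)
    (q : ℝ) (hq : 0 < q)
    (hsum : ∀ P : (∀ k, lp (fun _ : ℕ => 𝕂) (ENNReal.ofReal (r k))) → Y, IsMultiPoly 𝕂 n P →
      ∀ x : ∀ k, ℕ → lp (fun _ : ℕ => 𝕂) (ENNReal.ofReal (r k)),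
        (∀ k, WeaklySummable 𝕂 (x k)) → Summable fun j => ‖P fun k => x k j‖ ^ q) :
    1 / (∑ k, (n k : ℝ) / r k) ≤ q ∨ (2 ≤ q ∧ ∀ s : ℝ, q < s → HasCotype Y s) := by
  by_cases hql : 1 / (∑ k, (n k : ℝ) / r k) ≤ q
  · exact Or.inl hql
  right
  push Not at hql
  have hr0 : ∀ k, 0 < r k := fun k => by linarith [hr k]
  have hρ : 0 < ∑ k, (n k : ℝ) / r k := Finset.sum_pos
    (fun k _ => div_pos (by exact_mod_cast hn k) (hr0 k)) ⟨⟨0, hm⟩, Finset.mem_univ _⟩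
  generalize hlam' : 1 / (∑ k, (n k : ℝ) / r k) = lam at hql
  have hlam : 0 < lam := hlam' ▸ one_div_pos.mpr hρ
  have hw : ∑ i : Σ k : Fin m, Fin (n k), lam / r i.1 = 1 := by
    rw [Fintype.sum_sigma, ← one_div_mul_cancel hρ.ne', hlam', Finset.mul_sum]
    refine Finset.sum_congr rfl fun k _ => ?_
    simp only [Finset.sum_const, Finset.card_univ, Fintype.card_fin, nsmul_eq_mul]
    ring
  have hsub : 0 < 1 / q - 1 / lam := sub_pos.mpr (one_div_lt_one_div_of_lt hq hql)
  have ht : 1 / (1 / (1 / q - 1 / lam)) = 1 / q - 1 / lam := one_div_one_div _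
  have hA := exists_bound_of_summing hr hq hlam hql (one_div_pos.mpr hsub) ht hw hsum
  have : Nontrivial Y := by
    by_contra h
    rw [not_nontrivial_iff_subsingleton] at h
    exact hY inferInstance
  let _ : NormedSpace ℝ Y := NormedSpace.restrictScalars ℝ 𝕂 Y
  have : IsScalarTower ℝ 𝕂 Y := RestrictScalars.isScalarTower ℝ 𝕂 Y
  have hYR : ¬FiniteDimensional ℝ Y := fun h => hY (Module.Finite.of_restrictScalars_finite ℝ 𝕂 Y)
  exact two_le_and_hasCotype hYR hq (one_lt_of_bound hlam hA) hql (one_div_pos.mpr hsub) ht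
    (bound_restrictScalars hlam hA)
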